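/- arXiv:1306.2410 — 2 statements merged into one kernel-verified Lean document; each statement's English description precedes it below -/
import Mathlib

section
/- (Gaussian hypercontractivity.) Let n be a positive integer and define the Ornstein–Uhlenbeck semigroup by P_t f(x) = ∫_{ℝⁿ} f(e^{−t}x + √(1−e^{−2t}) y) dγₙ(y). If p, q > 1 and t ≥ 0 satisfy (p−1)/(q−1) ≥ e^{−2t}, then for every measurable f : ℝⁿ → ℝ, ‖P_t f‖_{L_q(γₙ)} ≤ ‖f‖_{L_p(γₙ)}. -/
open MeasureTheory ProbabilityTheory
open scoped ENNReal

/-- The standard Gaussian measure on `ι → ℝ`. -/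
noncomputable def stdGaussian (ι : Type*) [Fintype ι] : Measure (ι → ℝ) :=
  Measure.pi fun _ => gaussianReal 0 1

/-- The Ornstein-Uhlenbeck semigroup
`P_t f(x) = ∫ f(e^{-t} x + √(1 - e^{-2t}) y) dγₙ(y)`. -/
noncomputable def ouSemigroup (n : ℕ) (t : ℝ) (f : (Fin n → ℝ) → ℝ)
    (x : Fin n → ℝ) : ℝ :=
  ∫ y, f (Real.exp (-t) • x + Real.sqrt (1 - Real.exp (-2 * t)) • y)
    ∂(stdGaussian (Fin n))

open Set Filter Topology in
lemma cdf_props (F : ℝ → ℝ) (hF : Integrable F) (hpos : ∀ x, 0 < F x) (h1 : ∫ x, F x = 1) :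
    StrictMono (fun x => ∫ t in Iic x, F t) ∧ (∀ x, 0 < ∫ t in Iic x, F t) ∧
    (∀ x, ∫ t in Iic x, F t < 1) ∧
    (∀ᵐ x, HasDerivAt (fun x => ∫ t in Iic x, F t) (F x) x) := by
  have hmono : StrictMono (fun x => ∫ t in Iic x, F t) := by
    intro x y hxy
    have := intervalIntegral.integral_Iic_sub_Iic (a := x) (b := y) (hF.integrableOn (μ := volume))
      (hF.integrableOn (μ := volume))
    have h2 := intervalIntegral.intervalIntegral_pos_of_pos (f := F) (a := x) (b := y)
      hF.intervalIntegrable hpos hxy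
    simp only
    linarith
  have h0 : ∀ x, 0 ≤ ∫ t in Iic x, F t := fun x => integral_nonneg fun t => (hpos t).le
  have h1' : ∀ x, ∫ t in Iic x, F t ≤ 1 := fun x => h1 ▸
    setIntegral_le_integral hF (Eventually.of_forall fun t => (hpos t).le)
  refine ⟨hmono, fun x => ?_, fun x => ?_, ?_⟩
  · exact (h0 (x-1)).trans_lt (hmono (by linarith))
  · exact (hmono (show x < x + 1 by linarith)).trans_le (h1' (x+1))
  · filter_upwards [LocallyIntegrable.ae_hasDerivAt_integral hF.locallyIntegrable] with x hx
    have := (hx 0).add_const (∫ t in Iic 0, F t)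
    refine this.congr_of_eventuallyEq (Eventually.of_forall fun y => ?_)
    have := intervalIntegral.integral_Iic_sub_Iic (a := 0) (b := y) (hF.integrableOn (μ := volume))
      (hF.integrableOn (μ := volume))
    simp only
    linarith

open Set Filter Topology in
lemma exists_inv : ∃ g : ℝ → ℝ, StrictMonoOn g (Ioo 0 1) ∧
    ∀ y ∈ Ioo (0:ℝ) 1, HasDerivAt g (gaussianPDFReal 0 1 (g y))⁻¹ y := by
  set Φ : ℝ → ℝ := fun x => ∫ t in Iic x, gaussianPDFReal 0 1 t with hΦ
  have hint : Integrable (gaussianPDFReal 0 1) := integrable_gaussianPDFReal 0 1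
  have hcont : Continuous (gaussianPDFReal 0 1) := by
    rw [gaussianPDFReal_def]; fun_prop
  obtain ⟨hm, h0, h1, -⟩ := cdf_props (gaussianPDFReal 0 1) hint
    (fun x => gaussianPDFReal_pos 0 1 x one_ne_zero) (integral_gaussianPDFReal_eq_one 0 one_ne_zero)
  have hd : ∀ x, HasDerivAt Φ (gaussianPDFReal 0 1 x) x := by
    intro x
    have := (intervalIntegral.integral_hasDerivAt_right (a := 0) (b := x)
      hint.intervalIntegrable hcont.stronglyMeasurable.stronglyMeasurableAtFilter
      hcont.continuousAt).add_const (∫ t in Iic 0, gaussianPDFReal 0 1 t)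
    refine this.congr_of_eventuallyEq (Eventually.of_forall fun y => ?_)
    have := intervalIntegral.integral_Iic_sub_Iic (a := 0) (b := y)
      (hint.integrableOn (μ := volume)) (hint.integrableOn (μ := volume))
    simp only [hΦ]
    linarith
  have hΦc : Continuous Φ := continuous_iff_continuousAt.2 fun x => (hd x).continuousAt
  have hcdf : ∀ x, Φ x = cdf (gaussianReal 0 1) x := by
    intro x
    rw [cdf_eq_real, measureReal_def, gaussianReal_apply_eq_integral _ one_ne_zero,
      ENNReal.toReal_ofReal (h0 x).le]
  have hsurj : ∀ y ∈ Ioo (0:ℝ) 1, ∃ x, Φ x = y := by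
    intro y hy
    have a1 : ∃ a, Φ a ≤ y := by
      have := (tendsto_cdf_atBot (gaussianReal 0 1)).eventually (eventually_lt_nhds hy.1)
      obtain ⟨a, ha⟩ := this.exists
      exact ⟨a, (hcdf a).trans_le ha.le⟩
    have a2 : ∃ a, y ≤ Φ a := by
      have := (tendsto_cdf_atTop (gaussianReal 0 1)).eventually (eventually_gt_nhds hy.2)
      obtain ⟨a, ha⟩ := this.exists
      exact ⟨a, ha.le.trans (hcdf a).ge⟩
    exact mem_range_of_exists_le_of_exists_ge hΦc a1 a2
  have hinv : ∀ y ∈ Ioo (0:ℝ) 1, Φ (Function.invFun Φ y) = y := fun y hy =>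
    Function.invFun_eq (hsurj y hy)
  have hgm : StrictMonoOn (Function.invFun Φ) (Ioo 0 1) := by
    intro x hx y hy hxy
    rw [← hm.lt_iff_lt]
    change Φ _ < Φ _
    rwa [hinv x hx, hinv y hy]
  refine ⟨Function.invFun Φ, hgm, fun y hy => ?_⟩
  have hnh : Ioo (0:ℝ) 1 ∈ 𝓝 y := isOpen_Ioo.mem_nhds hy
  refine HasDerivAt.of_local_left_inverse (f := Φ) ?_ (hd _)
    (gaussianPDFReal_pos 0 1 _ one_ne_zero).ne' (by filter_upwards [hnh] with z hz using hinv z hz)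
  refine hgm.continuousAt_of_image_mem_nhds hnh ?_
  convert univ_mem
  refine eq_univ_of_forall fun x => ⟨Φ x, ⟨h0 x, h1 x⟩, Function.leftInverse_invFun hm.injective x⟩

open Set Filter Topology in
lemma exists_transport (f : ℝ → ℝ) (hf : Measurable f) (hpos : ∀ x, 0 < f x)
    (h1 : ∫⁻ x, ENNReal.ofReal (f x) ∂(gaussianReal 0 1) = 1) :
    ∃ (T T' : ℝ → ℝ) (A : Set ℝ), StrictMono T ∧ MeasurableSet A ∧ volume Aᶜ = 0 ∧
      (∀ x, 0 < T' x) ∧ (∀ x ∈ A, HasDerivAt T (T' x) x) ∧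
      ∀ x, f x = T' x * Real.exp ((x ^ 2 - T x ^ 2) / 2) := by
  obtain ⟨g, hgm, hgd⟩ := exists_inv
  set F : ℝ → ℝ := fun x => gaussianPDFReal 0 1 x * f x with hFdef
  have hφ : ∀ x, 0 < gaussianPDFReal 0 1 x := fun x => gaussianPDFReal_pos 0 1 x one_ne_zero
  have hFpos : ∀ x, 0 < F x := fun x => mul_pos (hφ x) (hpos x)
  have hFm : Measurable F := (measurable_gaussianPDFReal 0 1).mul hf
  have hl : ∫⁻ x, ENNReal.ofReal (F x) = 1 := by
    rw [← h1, gaussianReal_of_var_ne_zero _ one_ne_zero,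
      lintegral_withDensity_eq_lintegral_mul _ (measurable_gaussianPDF 0 1) (by fun_prop)]
    refine lintegral_congr fun x => ?_
    simp only [hFdef, Pi.mul_apply, gaussianPDF]
    rw [ENNReal.ofReal_mul (hφ x).le]
  have hFi : Integrable F := by
    refine ⟨hFm.aestronglyMeasurable, ?_⟩
    rw [hasFiniteIntegral_iff_ofReal (Eventually.of_forall fun x => (hFpos x).le), hl]
    exact ENNReal.one_lt_top
  have hF1 : ∫ x, F x = 1 := by
    rw [integral_eq_lintegral_of_nonneg_ae (Eventually.of_forall fun x => (hFpos x).le)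
      hFm.aestronglyMeasurable, hl, ENNReal.toReal_one]
  obtain ⟨hm, h0, h1', hd⟩ := cdf_props F hFi hFpos hF1
  obtain ⟨B, hB, hBm, hB0⟩ := exists_measurable_superset_of_null (ae_iff.1 hd)
  set T : ℝ → ℝ := fun x => g (∫ t in Iic x, F t) with hT
  refine ⟨T, fun x => (gaussianPDFReal 0 1 (T x))⁻¹ * F x, Bᶜ, ?_, hBm.compl, by simpa using hB0,
    fun x => mul_pos (inv_pos.2 (hφ _)) (hFpos x), ?_, ?_⟩
  · intro x y hxy
    exact hgm ⟨h0 x, h1' x⟩ ⟨h0 y, h1' y⟩ (hm hxy)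
  · intro x hx
    have hx' : HasDerivAt (fun x => ∫ t in Iic x, F t) (F x) x := by
      by_contra h
      exact hx (hB h)
    exact (hgd _ ⟨h0 x, h1' x⟩).comp x hx'
  · intro x
    have : Real.exp ((x ^ 2 - T x ^ 2) / 2) = gaussianPDFReal 0 1 (T x) / gaussianPDFReal 0 1 x := by
      simp only [gaussianPDFReal_def]
      rw [mul_div_mul_left _ _ (by positivity), ← Real.exp_sub]
      congr 1
      simp
      ring
    have a1 := (hφ x).ne'
    have a2 := (hφ (T x)).ne'
    rw [this]
    simp only [hFdef]
    field_simp

lemma jac_ge {a b r m n : ℝ} (ha : 0 < a) (ha1 : a < 1) (hb : 0 < b) (hb1 : b < 1)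
    (hr1 : r ^ 2 ≤ 1) (hab : r ^ 2 * (a * b) ≤ (1 - a) * (1 - b))
    (hm : 0 < m) (hn : 0 < n) :
    m ^ a * n ^ b ≤ (1 - a + a * m) * (1 - b + b * n) - r ^ 2 * (a * b) * ((m - 1) * (n - 1)) := by
  have hab0 : 0 < a * b := mul_pos ha hb
  have key := Real.geom_mean_le_arith_mean4_weighted
    (w₁ := (1 - a) * (1 - b) - r ^ 2 * (a * b)) (w₂ := a * (1 - b) + r ^ 2 * (a * b))
    (w₃ := b * (1 - a) + r ^ 2 * (a * b)) (w₄ := a * b - r ^ 2 * (a * b))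
    (p₁ := 1) (p₂ := m) (p₃ := n) (p₄ := m * n) (by linarith)
    (by have := mul_pos ha (sub_pos.2 hb1); positivity)
    (by have := mul_pos hb (sub_pos.2 ha1); positivity)
    (by nlinarith) zero_le_one hm.le hn.le (mul_pos hm hn).le (by ring)
  rw [Real.one_rpow, one_mul, Real.mul_rpow hm.le hn.le] at key
  calc m ^ a * n ^ b = m ^ (a * (1 - b) + r ^ 2 * (a * b)) * n ^ (b * (1 - a) + r ^ 2 * (a * b)) *
        (m ^ (a * b - r ^ 2 * (a * b)) * n ^ (a * b - r ^ 2 * (a * b))) := by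
        rw [mul_mul_mul_comm, ← Real.rpow_add hm, ← Real.rpow_add hn]
        ring_nf
    _ ≤ _ := key
    _ = _ := by ring

lemma jac_pos {a b r m n : ℝ} (ha : 0 < a) (ha1 : a < 1) (hb : 0 < b) (hb1 : b < 1)
    (hr1 : r ^ 2 ≤ 1) (hab : r ^ 2 * (a * b) ≤ (1 - a) * (1 - b))
    (hm : 0 < m) (hn : 0 < n) :
    0 < (1 - a + a * m) * (1 - b + b * n) - r ^ 2 * (a * b) * ((m - 1) * (n - 1)) :=
  lt_of_lt_of_le (by positivity) (jac_ge ha ha1 hb hb1 hr1 hab hm hn)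

/-- The transport map. -/
noncomputable def psiMap (a b r : ℝ) (T S : ℝ → ℝ) (z : ℝ × ℝ) : ℝ × ℝ :=
  (z.1 + a * (T z.1 - z.1) + r * b * (S z.2 - z.2), z.2 + r * a * (T z.1 - z.1) + b * (S z.2 - z.2))

/-- Its derivative. -/
noncomputable def psiDeriv (a b r : ℝ) (m n : ℝ) : ℝ × ℝ →L[ℝ] ℝ × ℝ :=
  (Matrix.toLin (.finTwoProd ℝ) (.finTwoProd ℝ)
    !![1 - a + a * m, r * b * (n - 1); r * a * (m - 1), 1 - b + b * n]).toContinuousLinearMap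

lemma det_psiDeriv (a b r m n : ℝ) : (psiDeriv a b r m n).det =
    (1 - a + a * m) * (1 - b + b * n) - r ^ 2 * (a * b) * ((m - 1) * (n - 1)) := by
  unfold psiDeriv
  simp only [LinearMap.det_toContinuousLinearMap, LinearMap.det_toLin, Matrix.det_fin_two_of]
  ring

lemma hasFDerivAt_psiMap (a b r : ℝ) (T S : ℝ → ℝ) (z : ℝ × ℝ) (m n : ℝ)
    (hT : HasDerivAt T m z.1) (hS : HasDerivAt S n z.2) :
    HasFDerivAt (psiMap a b r T S) (psiDeriv a b r m n) z := by
  unfold psiDeriv psiMap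
  rw [Matrix.toLin_finTwoProd_toContinuousLinearMap]
  have h1 : HasFDerivAt (fun z : ℝ × ℝ => z.1) (ContinuousLinearMap.fst ℝ ℝ ℝ) z := hasFDerivAt_fst
  have h2 : HasFDerivAt (fun z : ℝ × ℝ => z.2) (ContinuousLinearMap.snd ℝ ℝ ℝ) z := hasFDerivAt_snd
  have hT' : HasFDerivAt (fun z : ℝ × ℝ => T z.1) (m • ContinuousLinearMap.fst ℝ ℝ ℝ) z :=
    hT.comp_hasFDerivAt z h1
  have hS' : HasFDerivAt (fun z : ℝ × ℝ => S z.2) (n • ContinuousLinearMap.snd ℝ ℝ ℝ) z :=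
    hS.comp_hasFDerivAt z h2
  refine (HasFDerivAt.prodMk
    ((h1.add ((hT'.sub h1).const_mul a)).add ((hS'.sub h2).const_mul (r * b)))
    ((h2.add ((hT'.sub h1).const_mul (r * a))).add ((hS'.sub h2).const_mul b))).congr_fderiv ?_
  ext <;> simp <;> ring

lemma slope_pos {T : ℝ → ℝ} (hT : StrictMono T) (x y : ℝ) :
    ∃ m : ℝ, 0 < m ∧ T x - T y = m * (x - y) := by
  rcases lt_trichotomy x y with h | h | h
  · refine ⟨(T x - T y) / (x - y), div_pos_of_neg_of_neg (sub_neg.2 (hT h)) (sub_neg.2 h), ?_⟩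
    rw [div_mul_cancel₀ _ (sub_neg.2 h).ne]
  · exact ⟨1, one_pos, by simp [h]⟩
  · refine ⟨(T x - T y) / (x - y), div_pos (sub_pos.2 (hT h)) (sub_pos.2 h), ?_⟩
    rw [div_mul_cancel₀ _ (sub_pos.2 h).ne']

lemma psiMap_injective {a b r : ℝ} (ha : 0 < a) (ha1 : a < 1) (hb : 0 < b) (hb1 : b < 1)
    (hr1 : r ^ 2 ≤ 1) (hab : r ^ 2 * (a * b) ≤ (1 - a) * (1 - b)) {T S : ℝ → ℝ}
    (hT : StrictMono T) (hS : StrictMono S) : Function.Injective (psiMap a b r T S) := by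
  rintro ⟨x, y⟩ ⟨x', y'⟩ h
  simp only [psiMap, Prod.mk.injEq] at h
  obtain ⟨h1, h2⟩ := h
  obtain ⟨m, hm, hm'⟩ := slope_pos hT x x'
  obtain ⟨n, hn, hn'⟩ := slope_pos hS y y'
  have hJ := jac_pos ha ha1 hb hb1 hr1 hab hm hn
  set J := (1 - a + a * m) * (1 - b + b * n) - r ^ 2 * (a * b) * ((m - 1) * (n - 1)) with hJd
  have e1 : (1 - a + a * m) * (x - x') + r * b * (n - 1) * (y - y') = 0 := by
    linear_combination h1 - a * hm' - r * b * hn'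
  have e2 : r * a * (m - 1) * (x - x') + (1 - b + b * n) * (y - y') = 0 := by
    linear_combination h2 - r * a * hm' - b * hn'
  have f1 : J * (x - x') = 0 := by
    rw [hJd]; linear_combination (1 - b + b * n) * e1 - r * b * (n - 1) * e2
  have f2 : J * (y - y') = 0 := by
    rw [hJd]; linear_combination (1 - a + a * m) * e2 - r * a * (m - 1) * e1
  have g1 := (mul_eq_zero.1 f1).resolve_left hJ.ne'
  have g2 := (mul_eq_zero.1 f2).resolve_left hJ.ne'
  ext <;> simp <;> linarith

/-- joint density of two correlated Gaussians. -/
noncomputable def jd (r : ℝ) (v : NNReal) (z : ℝ × ℝ) : ℝ :=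
  gaussianPDFReal 0 1 z.1 * gaussianPDFReal (r * z.1) v z.2

lemma jd_eq (r : ℝ) (v : NNReal) (hv : (v : ℝ) = 1 - r ^ 2) (hv0 : v ≠ 0) (z : ℝ × ℝ) :
    jd r v z = ((√(2 * Real.pi))⁻¹ * (√(2 * Real.pi * v))⁻¹) *
      Real.exp (-(z.1 ^ 2 - 2 * r * z.1 * z.2 + z.2 ^ 2) / (2 * v)) := by
  have : (v : ℝ) ≠ 0 := by exact_mod_cast hv0
  simp only [jd, gaussianPDFReal_def]
  rw [mul_mul_mul_comm, ← Real.exp_add]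
  congr 2
  · simp
  · simp only [NNReal.coe_one]
    field_simp
    rw [hv]
    ring

lemma pointwise_bound {a b r : ℝ} (ha : 0 < a) (ha1 : a < 1) (hb : 0 < b) (hb1 : b < 1)
    (hr1 : r ^ 2 < 1) (hab : r ^ 2 * (a * b) ≤ (1 - a) * (1 - b)) (v : NNReal)
    (hv : (v : ℝ) = 1 - r ^ 2) (hv0 : v ≠ 0) (T S : ℝ → ℝ) (z : ℝ × ℝ) (m n : ℝ)
    (hm : 0 < m) (hn : 0 < n) :
    (m * Real.exp ((z.1 ^ 2 - T z.1 ^ 2) / 2)) ^ a * (n * Real.exp ((z.2 ^ 2 - S z.2 ^ 2) / 2)) ^ b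
      * jd r v z ≤ |(psiDeriv a b r m n).det| * jd r v (psiMap a b r T S z) := by
  have hJ := jac_ge ha ha1 hb hb1 hr1.le hab hm hn
  rw [det_psiDeriv, abs_of_pos (jac_pos ha ha1 hb hb1 hr1.le hab hm hn), jd_eq r v hv hv0,
    jd_eq r v hv hv0, Real.mul_rpow hm.le (Real.exp_pos _).le,
    Real.mul_rpow hn.le (Real.exp_pos _).le, ← Real.exp_mul, ← Real.exp_mul]
  set C := ((√(2 * Real.pi))⁻¹ * (√(2 * Real.pi * v))⁻¹)
  have hC : 0 ≤ C := by positivity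
  have hvp : 0 < (v : ℝ) := by positivity
  obtain ⟨x, y⟩ := z
  simp only [psiMap]
  obtain ⟨u, hu⟩ : ∃ u, T x = x + u := ⟨T x - x, by ring⟩
  obtain ⟨w, hw⟩ : ∃ w, S y = y + w := ⟨S y - y, by ring⟩
  rw [hu, hw]
  have hE : Real.exp ((x ^ 2 - (x + u) ^ 2) / 2 * a) * Real.exp ((y ^ 2 - (y + w) ^ 2) / 2 * b) *
      Real.exp (-(x ^ 2 - 2 * r * x * y + y ^ 2) / (2 * v)) ≤
      Real.exp (-((x + a * (x + u - x) + r * b * (y + w - y)) ^ 2 -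
        2 * r * (x + a * (x + u - x) + r * b * (y + w - y)) *
          (y + r * a * (x + u - x) + b * (y + w - y)) +
        (y + r * a * (x + u - x) + b * (y + w - y)) ^ 2) / (2 * v)) := by
    rw [← Real.exp_add, ← Real.exp_add, Real.exp_le_exp]
    have hq : 0 ≤ a * (1 - a) * u ^ 2 - 2 * r * a * b * u * w + b * (1 - b) * w ^ 2 := by
      have h1a : 0 < 1 - a := by linarith
      have h1b : 0 < 1 - b := by linarith
      have : 0 ≤ (a * (1 - a)) * (a * (1 - a) * u ^ 2 - 2 * r * a * b * u * w + b * (1 - b) * w ^ 2) := by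
        have e : (a * (1 - a)) * (a * (1 - a) * u ^ 2 - 2 * r * a * b * u * w + b * (1 - b) * w ^ 2)
          = (a * (1 - a) * u - r * a * b * w) ^ 2 +
            (a * b * w ^ 2) * ((1 - a) * (1 - b) - r ^ 2 * (a * b)) := by ring
        rw [e]
        have := sub_nonneg.2 hab
        positivity
      exact nonneg_of_mul_nonneg_right this (by positivity)
    have hid : -((x + a * (x + u - x) + r * b * (y + w - y)) ^ 2 -
        2 * r * (x + a * (x + u - x) + r * b * (y + w - y)) *
          (y + r * a * (x + u - x) + b * (y + w - y)) +
        (y + r * a * (x + u - x) + b * (y + w - y)) ^ 2) / (2 * v) =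
        (x ^ 2 - (x + u) ^ 2) / 2 * a + (y ^ 2 - (y + w) ^ 2) / 2 * b +
        -(x ^ 2 - 2 * r * x * y + y ^ 2) / (2 * v) +
        (a * (1 - a) * u ^ 2 - 2 * r * a * b * u * w + b * (1 - b) * w ^ 2) / 2 := by
      field_simp
      rw [hv]
      ring
    rw [hid]
    linarith
  calc _ = (m ^ a * n ^ b) * (C * (Real.exp ((x ^ 2 - (x + u) ^ 2) / 2 * a) * Real.exp ((y ^ 2 - (y + w) ^ 2) / 2 * b) *
      Real.exp (-(x ^ 2 - 2 * r * x * y + y ^ 2) / (2 * v)))) := by ring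
    _ ≤ _ := by
      have := (show 0 ≤ m ^ a * n ^ b by positivity).trans hJ
      gcongr

open Set in
lemma core_ineq {a b r : ℝ} (ha : 0 < a) (ha1 : a < 1) (hb : 0 < b) (hb1 : b < 1)
    (hr1 : r ^ 2 < 1) (hab : r ^ 2 * (a * b) ≤ (1 - a) * (1 - b)) (v : NNReal)
    (hv : (v : ℝ) = 1 - r ^ 2) (hv0 : v ≠ 0) (f g : ℝ → ℝ) (hf : Measurable f) (hg : Measurable g)
    (hfp : ∀ x, 0 < f x) (hgp : ∀ x, 0 < g x)
    (hf1 : ∫⁻ x, ENNReal.ofReal (f x) ∂(gaussianReal 0 1) = 1)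
    (hg1 : ∫⁻ x, ENNReal.ofReal (g x) ∂(gaussianReal 0 1) = 1) :
    ∫⁻ z : ℝ × ℝ, ENNReal.ofReal (f z.1 ^ a * g z.2 ^ b * jd r v z) ≤
      ∫⁻ z : ℝ × ℝ, ENNReal.ofReal (jd r v z) := by
  obtain ⟨T, T', A, hT, hA, hA0, hT', hTd, hTf⟩ := exists_transport f hf hfp hf1
  obtain ⟨S, S', B, hS, hB, hB0, hS', hSd, hSg⟩ := exists_transport g hg hgp hg1
  have hAB : MeasurableSet (A ×ˢ B) := hA.prod hB
  have hae : ∀ᵐ z : ℝ × ℝ, z ∈ A ×ˢ B := by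
    have h1 : ∀ᵐ x : ℝ, x ∈ A := by rw [ae_iff]; exact hA0
    have h2 : ∀ᵐ x : ℝ, x ∈ B := by rw [ae_iff]; exact hB0
    have h1' := (Measure.quasiMeasurePreserving_fst (μ := (volume : Measure ℝ))
      (ν := (volume : Measure ℝ))).ae h1
    have h2' := (Measure.quasiMeasurePreserving_snd (μ := (volume : Measure ℝ))
      (ν := (volume : Measure ℝ))).ae h2
    rw [Measure.volume_eq_prod]
    filter_upwards [h1', h2'] with z hz1 hz2 using ⟨hz1, hz2⟩
  have hcv := lintegral_image_eq_lintegral_abs_det_fderiv_mul (volume : Measure (ℝ × ℝ)) hAB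
    (f := psiMap a b r T S) (f' := fun z => psiDeriv a b r (T' z.1) (S' z.2))
    (fun z hz => (hasFDerivAt_psiMap a b r T S z _ _ (hTd _ hz.1) (hSd _ hz.2)).hasFDerivWithinAt)
    (psiMap_injective ha ha1 hb hb1 hr1.le hab hT hS).injOn
    (fun z => ENNReal.ofReal (jd r v z))
  calc ∫⁻ z : ℝ × ℝ, ENNReal.ofReal (f z.1 ^ a * g z.2 ^ b * jd r v z)
      = ∫⁻ z in A ×ˢ B, ENNReal.ofReal (f z.1 ^ a * g z.2 ^ b * jd r v z) := by
        rw [Measure.restrict_eq_self_of_ae_mem hae]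
    _ ≤ ∫⁻ z in A ×ˢ B, ENNReal.ofReal |(psiDeriv a b r (T' z.1) (S' z.2)).det| *
          ENNReal.ofReal (jd r v (psiMap a b r T S z)) := by
        refine lintegral_mono fun z => ?_
        rw [← ENNReal.ofReal_mul (abs_nonneg _)]
        refine ENNReal.ofReal_le_ofReal ?_
        rw [hTf z.1, hSg z.2]
        exact pointwise_bound ha ha1 hb hb1 hr1 hab v hv hv0 T S z _ _ (hT' _) (hS' _)
    _ = ∫⁻ z in psiMap a b r T S '' (A ×ˢ B), ENNReal.ofReal (jd r v z) := hcv.symm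
    _ ≤ _ := setLIntegral_le_lintegral _ _

lemma lintegral_jd (r s : ℝ) (hs : s ≠ 0) (v : NNReal) (hv : (v : ℝ) = s ^ 2)
    (h : ℝ × ℝ → ℝ≥0∞) (hh : Measurable h) :
    ∫⁻ x, ∫⁻ y, h (x, r * x + s * y) ∂(gaussianReal 0 1) ∂(gaussianReal 0 1) =
      ∫⁻ z : ℝ × ℝ, h z * ENNReal.ofReal (jd r v z) := by
  have hv0 : v ≠ 0 := by
    intro h0
    rw [h0] at hv
    have : s ^ 2 ≠ 0 := by positivity
    exact this hv.symm
  have hmap : ∀ x : ℝ, (gaussianReal 0 1).map (fun y => r * x + s * y) = gaussianReal (r * x) v := by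
    intro x
    have e : (fun y : ℝ => r * x + s * y) = (fun y => r * x + y) ∘ (fun y => s * y) := rfl
    rw [e, ← Measure.map_map (by fun_prop) (by fun_prop), gaussianReal_map_const_mul,
      gaussianReal_map_const_add]
    congr 1
    · ring
    · ext; simp [hv]
  have hjm : Measurable (fun z : ℝ × ℝ => gaussianPDF (r * z.1) v z.2) := by
    have : Measurable (fun z : ℝ × ℝ => (r * z.1, v, z.2)) := by fun_prop
    exact measurable_uncurry_gaussianPDF.comp this
  have inner : ∀ x, ∫⁻ y, h (x, r * x + s * y) ∂(gaussianReal 0 1) =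
      ∫⁻ y, gaussianPDF (r * x) v y * h (x, y) := by
    intro x
    have hx : Measurable fun y => h (x, y) := by fun_prop
    rw [← lintegral_map (μ := gaussianReal 0 1) (f := fun y => h (x, y))
      (g := fun y => r * x + s * y) hx (by fun_prop), hmap x, gaussianReal_of_var_ne_zero _ hv0,
      lintegral_withDensity_eq_lintegral_mul _ (measurable_gaussianPDF _ _) hx]
    rfl
  simp_rw [inner]
  rw [gaussianReal_of_var_ne_zero _ one_ne_zero,
    lintegral_withDensity_eq_lintegral_mul _ (measurable_gaussianPDF _ _)
      (Measurable.lintegral_prod_right' (f := fun z : ℝ × ℝ => gaussianPDF (r * z.1) v z.2 * h z)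
        (hjm.mul hh))]
  rw [Measure.volume_eq_prod, lintegral_prod]
  · refine lintegral_congr fun x => ?_
    simp only [Pi.mul_apply]
    rw [← lintegral_const_mul _ (by
      have : Measurable fun y => h (x, y) := by fun_prop
      exact (measurable_gaussianPDF _ _).mul this)]
    refine lintegral_congr fun y => ?_
    simp only [jd]
    rw [ENNReal.ofReal_mul (gaussianPDFReal_nonneg _ _ _)]
    simp only [gaussianPDF]
    ring
  · refine (hh.mul (ENNReal.measurable_ofReal.comp ?_)).aemeasurable
    unfold jd
    have : Measurable (fun z : ℝ × ℝ => (r * z.1, v, z.2)) := by fun_prop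
    exact ((measurable_gaussianPDFReal 0 1).comp measurable_fst).mul
      (measurable_uncurry_gaussianPDFReal.comp this)

lemma lintegral_jd_one (r s : ℝ) (hs : s ≠ 0) (v : NNReal) (hv : (v : ℝ) = s ^ 2) :
    ∫⁻ z : ℝ × ℝ, ENNReal.ofReal (jd r v z) = 1 := by
  have := lintegral_jd r s hs v hv (fun _ => 1) measurable_const
  simpa using this.symm

lemma norm_rpow (u I : ℝ≥0∞) (hu : u ≠ ⊤) (hI0 : I ≠ 0) (hI : I ≠ ⊤) (a : ℝ)
    (ha : 0 < a) : u ^ a = I ^ a * ENNReal.ofReal ((u / I).toReal ^ a) := by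
  have h : u / I ≠ ⊤ := ENNReal.div_ne_top hu hI0
  rw [← ENNReal.ofReal_rpow_of_nonneg ENNReal.toReal_nonneg ha.le, ENNReal.ofReal_toReal h,
    ← ENNReal.mul_rpow_of_nonneg _ _ ha.le, ENNReal.mul_div_cancel hI0 hI]

lemma one_dim_A {a b r s : ℝ} (ha : 0 < a) (ha1 : a < 1) (hb : 0 < b) (hb1 : b < 1)
    (hs : s ≠ 0) (hrs : r ^ 2 + s ^ 2 = 1) (hab : r ^ 2 * (a * b) ≤ (1 - a) * (1 - b))
    (u w : ℝ → ℝ≥0∞) (hu : Measurable u) (hw : Measurable w)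
    (hu0 : ∀ x, u x ≠ 0) (hut : ∀ x, u x ≠ ⊤) (hw0 : ∀ x, w x ≠ 0) (hwt : ∀ x, w x ≠ ⊤)
    (hui : ∫⁻ x, u x ∂(gaussianReal 0 1) ≠ ⊤) (hwi : ∫⁻ x, w x ∂(gaussianReal 0 1) ≠ ⊤) :
    ∫⁻ x, ∫⁻ y, u x ^ a * w (r * x + s * y) ^ b ∂(gaussianReal 0 1) ∂(gaussianReal 0 1) ≤
      (∫⁻ x, u x ∂(gaussianReal 0 1)) ^ a * (∫⁻ x, w x ∂(gaussianReal 0 1)) ^ b := by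
  set v : NNReal := ⟨s ^ 2, sq_nonneg s⟩ with hvdef
  have hv : (v : ℝ) = s ^ 2 := rfl
  have hs2 : 0 < s ^ 2 := by positivity
  have hv0 : v ≠ 0 := by
    intro h0
    rw [h0] at hv
    exact hs2.ne hv
  have main : ∀ u : ℝ → ℝ≥0∞, Measurable u → (∀ x, u x ≠ 0) → (∀ x, u x ≠ ⊤) →
      ∫⁻ x, u x ∂(gaussianReal 0 1) ≠ ⊤ → ∫⁻ x, u x ∂(gaussianReal 0 1) ≠ 0 ∧
      Measurable (fun x => (u x / ∫⁻ x, u x ∂(gaussianReal 0 1)).toReal) ∧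
      (∀ x, 0 < (u x / ∫⁻ x, u x ∂(gaussianReal 0 1)).toReal) ∧
      ∫⁻ x, ENNReal.ofReal ((u x / ∫⁻ x, u x ∂(gaussianReal 0 1)).toReal) ∂(gaussianReal 0 1)
        = 1 := by
    intro u hu hu0 hut hui
    have hI0 : ∫⁻ x, u x ∂(gaussianReal 0 1) ≠ 0 := by
      rw [Ne, lintegral_eq_zero_iff hu]
      intro h
      have := h.exists
      obtain ⟨x, hx⟩ := this
      exact hu0 x hx
    refine ⟨hI0, by fun_prop, fun x => ENNReal.toReal_pos (ENNReal.div_ne_zero.2 ⟨hu0 x, hui⟩)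
      (ENNReal.div_ne_top (hut x) hI0), ?_⟩
    simp_rw [ENNReal.ofReal_toReal (ENNReal.div_ne_top (hut _) hI0), div_eq_mul_inv]
    rw [lintegral_mul_const _ hu, ENNReal.mul_inv_cancel hI0 hui]
  obtain ⟨hI0, fm, fp, f1⟩ := main u hu hu0 hut hui
  obtain ⟨hJ0, gm, gp, g1⟩ := main w hw hw0 hwt hwi
  set I := ∫⁻ x, u x ∂(gaussianReal 0 1)
  set J := ∫⁻ x, w x ∂(gaussianReal 0 1)
  have key := core_ineq ha ha1 hb hb1 (by linarith) hab v (by rw [hv]; linarith) hv0 _ _ fm gm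
    fp gp f1 g1
  rw [lintegral_jd_one r s hs v hv] at key
  rw [lintegral_jd r s hs v hv (fun z => u z.1 ^ a * w z.2 ^ b) (by fun_prop)]
  have hm : Measurable (jd r v) := by
    unfold jd
    have : Measurable (fun z : ℝ × ℝ => (r * z.1, v, z.2)) := by fun_prop
    exact ((measurable_gaussianPDFReal 0 1).comp measurable_fst).mul
      (measurable_uncurry_gaussianPDFReal.comp this)
  calc ∫⁻ z : ℝ × ℝ, u z.1 ^ a * w z.2 ^ b * ENNReal.ofReal (jd r v z)
      = ∫⁻ z : ℝ × ℝ, (I ^ a * J ^ b) *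
        ENNReal.ofReal ((u z.1 / I).toReal ^ a * (w z.2 / J).toReal ^ b * jd r v z) := by
        refine lintegral_congr fun z => ?_
        rw [norm_rpow (u z.1) I (hut _) hI0 hui a ha, norm_rpow (w z.2) J (hwt _) hJ0 hwi b hb,
          ENNReal.ofReal_mul (by positivity), ENNReal.ofReal_mul (by positivity)]
        ring
    _ = (I ^ a * J ^ b) * ∫⁻ z : ℝ × ℝ,
        ENNReal.ofReal ((u z.1 / I).toReal ^ a * (w z.2 / J).toReal ^ b * jd r v z) := by
        refine lintegral_const_mul _ ?_
        have h1 : Measurable fun z : ℝ × ℝ => (u z.1 / I).toReal := fm.comp measurable_fst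
        have h2 : Measurable fun z : ℝ × ℝ => (w z.2 / J).toReal := gm.comp measurable_snd
        exact ENNReal.measurable_ofReal.comp (((h1.pow_const a).mul (h2.pow_const b)).mul hm)
    _ ≤ (I ^ a * J ^ b) * 1 := by gcongr
    _ = _ := mul_one _

open Filter Topology in
lemma one_dim_B {a b r s : ℝ} (ha : 0 < a) (ha1 : a < 1) (hb : 0 < b) (hb1 : b < 1)
    (hs : s ≠ 0) (hrs : r ^ 2 + s ^ 2 = 1) (hab : r ^ 2 * (a * b) ≤ (1 - a) * (1 - b))
    (u w : ℝ → ℝ≥0∞) (hu : Measurable u) (hw : Measurable w) (K : ℝ≥0∞) (hK : K ≠ ⊤)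
    (hut : ∀ x, u x ≤ K) (hwt : ∀ x, w x ≤ K) :
    ∫⁻ x, ∫⁻ y, u x ^ a * w (r * x + s * y) ^ b ∂(gaussianReal 0 1) ∂(gaussianReal 0 1) ≤
      (∫⁻ x, u x ∂(gaussianReal 0 1)) ^ a * (∫⁻ x, w x ∂(gaussianReal 0 1)) ^ b := by
  have hfin : ∀ u : ℝ → ℝ≥0∞, (∀ x, u x ≤ K) → ∫⁻ x, u x ∂(gaussianReal 0 1) ≠ ⊤ := by
    intro u h
    refine ((lintegral_mono h).trans_lt ?_).ne
    simpa using hK.lt_top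
  have hub := hfin u hut
  have hwb := hfin w hwt
  have step : ∀ ε : ℝ≥0∞, ε ≠ 0 → ε ≠ ⊤ →
      ∫⁻ x, ∫⁻ y, u x ^ a * w (r * x + s * y) ^ b ∂(gaussianReal 0 1) ∂(gaussianReal 0 1) ≤
      (∫⁻ x, u x ∂(gaussianReal 0 1) + ε) ^ a * (∫⁻ x, w x ∂(gaussianReal 0 1) + ε) ^ b := by
    intro ε h0 ht
    have e : ∀ u : ℝ → ℝ≥0∞, ∫⁻ x, (u x + ε) ∂(gaussianReal 0 1) =
        ∫⁻ x, u x ∂(gaussianReal 0 1) + ε := by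
      intro u
      rw [lintegral_add_right _ measurable_const]; simp
    rw [← e, ← e]
    refine le_trans ?_ (one_dim_A ha ha1 hb hb1 hs hrs hab (fun x => u x + ε) (fun x => w x + ε)
      (by fun_prop) (by fun_prop) (fun x => by simp [h0])
      (fun x => ENNReal.add_ne_top.2 ⟨((hut x).trans_lt hK.lt_top).ne, ht⟩) (fun x => by simp [h0])
      (fun x => ENNReal.add_ne_top.2 ⟨((hwt x).trans_lt hK.lt_top).ne, ht⟩)
      (by rw [e]; exact ENNReal.add_ne_top.2 ⟨hub, ht⟩)
      (by rw [e]; exact ENNReal.add_ne_top.2 ⟨hwb, ht⟩))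
    refine lintegral_mono fun x => lintegral_mono fun y => ?_
    simp only
    gcongr <;> exact le_self_add
  have hlim : ∀ I : ℝ≥0∞, ∀ c : ℝ, Tendsto (fun n : ℕ => (I + ((n : ℝ≥0∞) + 1)⁻¹) ^ c) atTop
      (𝓝 (I ^ c)) := by
    intro I c
    have h1 : Tendsto (fun n : ℕ => ((n : ℝ≥0∞) + 1)⁻¹) atTop (𝓝 0) := by
      have := (tendsto_add_atTop_iff_nat 1).2 ENNReal.tendsto_inv_nat_nhds_zero
      simpa using this
    have h2 : Tendsto (fun n : ℕ => (I + ((n : ℝ≥0∞) + 1)⁻¹)) atTop (𝓝 I) := by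
      simpa using tendsto_const_nhds.add h1
    exact (ENNReal.continuous_rpow_const.tendsto I).comp h2
  refine ge_of_tendsto' (ENNReal.Tendsto.mul (hlim _ a) (Or.inr ?_) (hlim _ b) (Or.inr ?_))
    (fun n => step ((n : ℝ≥0∞) + 1)⁻¹ (by simp) (by simp))
  · exact ENNReal.rpow_ne_top_of_nonneg hb.le hwb
  · exact ENNReal.rpow_ne_top_of_nonneg ha.le hub

lemma iSup_min_nat (x : ℝ≥0∞) : ⨆ n : ℕ, min x n = x := by
  rw [← inf_iSup_eq, ENNReal.iSup_natCast, inf_top_eq]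

lemma iSup_min_rpow (x : ℝ≥0∞) {a : ℝ} (ha : 0 < a) : ⨆ n : ℕ, (min x n) ^ a = x ^ a := by
  have := (ENNReal.orderIsoRpow a ha).map_iSup (fun n : ℕ => min x n)
  simp only [ENNReal.orderIsoRpow_apply] at this
  rw [← this, iSup_min_nat]

lemma min_nat_mono (x : ℝ≥0∞) : Monotone (fun n : ℕ => min x n) := by
  intro m n h
  simp only
  gcongr

lemma one_dim {a b r s : ℝ} (ha : 0 < a) (ha1 : a < 1) (hb : 0 < b) (hb1 : b < 1)
    (hs : s ≠ 0) (hrs : r ^ 2 + s ^ 2 = 1) (hab : r ^ 2 * (a * b) ≤ (1 - a) * (1 - b))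
    (u w : ℝ → ℝ≥0∞) (hu : Measurable u) (hw : Measurable w) :
    ∫⁻ x, ∫⁻ y, u x ^ a * w (r * x + s * y) ^ b ∂(gaussianReal 0 1) ∂(gaussianReal 0 1) ≤
      (∫⁻ x, u x ∂(gaussianReal 0 1)) ^ a * (∫⁻ x, w x ∂(gaussianReal 0 1)) ^ b := by
  have step : ∀ n : ℕ, ∫⁻ x, ∫⁻ y, (min (u x) n) ^ a * (min (w (r * x + s * y)) n) ^ b
      ∂(gaussianReal 0 1) ∂(gaussianReal 0 1) ≤
      (∫⁻ x, u x ∂(gaussianReal 0 1)) ^ a * (∫⁻ x, w x ∂(gaussianReal 0 1)) ^ b := by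
    intro n
    refine (one_dim_B ha ha1 hb hb1 hs hrs hab (fun x => min (u x) n) (fun x => min (w x) n)
      (by fun_prop) (by fun_prop) n (ENNReal.natCast_ne_top n) (fun x => min_le_right _ _)
      (fun x => min_le_right _ _)).trans ?_
    gcongr <;> exact min_le_left _ _
  have hmono : ∀ x y, Monotone (fun n : ℕ => (min (u x) n) ^ a * (min (w (r * x + s * y)) n) ^ b) := by
    intro x y m n h
    simp only
    gcongr
  have e : ∀ x y, u x ^ a * w (r * x + s * y) ^ b =
      ⨆ n : ℕ, (min (u x) n) ^ a * (min (w (r * x + s * y)) n) ^ b := by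
    intro x y
    rw [← iSup_min_rpow (u x) ha, ← iSup_min_rpow (w _) hb]
    apply le_antisymm
    · rw [ENNReal.iSup_mul]
      refine iSup_le fun i => ?_
      rw [ENNReal.mul_iSup]
      refine iSup_le fun j => ?_
      refine le_trans ?_ (le_iSup _ (max i j))
      gcongr
      · exact le_max_left i j
      · exact le_max_right i j
    · refine iSup_le fun i => ?_
      gcongr
      · exact le_iSup (fun n : ℕ => (min (u x) n) ^ a) i
      · exact le_iSup (fun n : ℕ => (min (w (r * x + s * y)) n) ^ b) i
  have hmeas : ∀ n : ℕ, Measurable (fun z : ℝ × ℝ =>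
      (min (u z.1) n) ^ a * (min (w (r * z.1 + s * z.2)) n) ^ b) := by intro n; fun_prop
  simp_rw [e]
  have e2 : ∀ x, ∫⁻ y, ⨆ n : ℕ, (min (u x) n) ^ a * (min (w (r * x + s * y)) n) ^ b
      ∂(gaussianReal 0 1) = ⨆ n : ℕ, ∫⁻ y, (min (u x) n) ^ a * (min (w (r * x + s * y)) n) ^ b
      ∂(gaussianReal 0 1) := by
    intro x
    exact lintegral_iSup (fun n => by fun_prop) (fun m n h y => hmono x y h)
  simp_rw [e2]
  rw [lintegral_iSup (fun n => (hmeas n).lintegral_prod_right')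
    (fun m n h x => lintegral_mono fun y => hmono x y h)]
  exact iSup_le step

instance instProbStdGaussian (ι : Type*) [Fintype ι] : IsProbabilityMeasure (stdGaussian ι) := by
  unfold _root_.stdGaussian; infer_instance

lemma measurable_cons (n : ℕ) :
    Measurable (fun z : ℝ × (Fin n → ℝ) => (Fin.cons z.1 z.2 : Fin (n + 1) → ℝ)) := by
  refine measurable_pi_lambda _ fun i => ?_
  refine Fin.cases ?_ (fun j => ?_) i
  · simpa using measurable_fst
  · simp only [Fin.cons_succ]
    exact (measurable_pi_apply j).comp measurable_snd

lemma lintegral_stdGaussian_succ (n : ℕ) (h : (Fin (n + 1) → ℝ) → ℝ≥0∞) (hh : Measurable h) :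
    ∫⁻ x, h x ∂(stdGaussian (Fin (n + 1))) =
      ∫⁻ x0, ∫⁻ x, h (Fin.cons x0 x) ∂(stdGaussian (Fin n)) ∂(gaussianReal 0 1) := by
  have mp := (measurePreserving_piFinSuccAbove (fun _ : Fin (n + 1) => gaussianReal 0 1) 0).symm
  have := mp.lintegral_comp hh
  unfold _root_.stdGaussian
  rw [← this, lintegral_prod]
  · refine lintegral_congr fun x0 => lintegral_congr fun x => ?_
    congr 1
    ext i
    refine Fin.cases ?_ (fun j => ?_) i <;> simp [MeasurableEquiv.piFinSuccAbove, Fin.insertNthEquiv]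
  · exact (hh.comp (MeasurableEquiv.measurable _)).aemeasurable

lemma cons_affine (n : ℕ) (r s x0 y0 : ℝ) (x y : Fin n → ℝ) :
    r • (Fin.cons x0 x : Fin (n + 1) → ℝ) + s • (Fin.cons y0 y : Fin (n + 1) → ℝ) =
      Fin.cons (r * x0 + s * y0) (r • x + s • y) := by
  ext i
  refine Fin.cases ?_ (fun j => ?_) i <;> simp

lemma n_dim {a b r s : ℝ} (ha : 0 < a) (ha1 : a < 1) (hb : 0 < b) (hb1 : b < 1)
    (hs : s ≠ 0) (hrs : r ^ 2 + s ^ 2 = 1) (hab : r ^ 2 * (a * b) ≤ (1 - a) * (1 - b)) (n : ℕ) :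
    ∀ (u w : (Fin n → ℝ) → ℝ≥0∞) (_ : Measurable u) (_ : Measurable w),
    ∫⁻ x, ∫⁻ y, u x ^ a * w (r • x + s • y) ^ b ∂(stdGaussian (Fin n)) ∂(stdGaussian (Fin n)) ≤
      (∫⁻ x, u x ∂(stdGaussian (Fin n))) ^ a * (∫⁻ x, w x ∂(stdGaussian (Fin n))) ^ b := by
  induction n with
  | zero =>
    intro u w hu hw
    have e1 : u = fun _ => u 0 := by ext x; rw [Subsingleton.elim x 0]
    have e2 : w = fun _ => w 0 := by ext x; rw [Subsingleton.elim x 0]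
    rw [e1, e2]
    simp
  | succ n ih =>
    intro u w hu hw
    have hc := measurable_cons n
    have hU : Measurable (fun x0 => ∫⁻ x, u (Fin.cons x0 x) ∂(stdGaussian (Fin n))) :=
      (hu.comp hc).lintegral_prod_right'
    have hW : Measurable (fun x0 => ∫⁻ x, w (Fin.cons x0 x) ∂(stdGaussian (Fin n))) :=
      (hw.comp hc).lintegral_prod_right'
    have hmeas : Measurable (fun z : (Fin (n + 1) → ℝ) × (Fin (n + 1) → ℝ) =>
        u z.1 ^ a * w (r • z.1 + s • z.2) ^ b) := by fun_prop
    rw [lintegral_stdGaussian_succ n _ hu, lintegral_stdGaussian_succ n _ hw,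
      lintegral_stdGaussian_succ n _ hmeas.lintegral_prod_right']
    refine le_trans ?_ (one_dim ha ha1 hb hb1 hs hrs hab _ _ hU hW)
    refine lintegral_mono fun x0 => ?_
    have e : ∀ x : Fin n → ℝ, ∫⁻ y, u (Fin.cons x0 x) ^ a * w (r • (Fin.cons x0 x) + s • y) ^ b
        ∂(stdGaussian (Fin (n + 1))) =
        ∫⁻ y0, ∫⁻ y, u (Fin.cons x0 x) ^ a *
          w (Fin.cons (r * x0 + s * y0) (r • x + s • y)) ^ b
          ∂(stdGaussian (Fin n)) ∂(gaussianReal 0 1) := by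
      intro x
      rw [lintegral_stdGaussian_succ n _ (by fun_prop)]
      simp_rw [cons_affine]
    simp only
    simp_rw [e]
    rw [lintegral_lintegral_swap]
    · refine lintegral_mono fun y0 => ?_
      refine ih (fun x => u (Fin.cons x0 x)) (fun x => w (Fin.cons (r * x0 + s * y0) x)) ?_ ?_
      · exact hu.comp (hc.comp (measurable_const.prodMk measurable_id))
      · exact hw.comp (hc.comp (measurable_const.prodMk measurable_id))
    · have h3 : Measurable (fun q : ((Fin n → ℝ) × ℝ) × (Fin n → ℝ) =>
          u (Fin.cons x0 q.1.1) ^ a *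
          w (Fin.cons (r * x0 + s * q.1.2) (r • q.1.1 + s • q.2)) ^ b) := by
        have m1 : Measurable (fun q : ((Fin n → ℝ) × ℝ) × (Fin n → ℝ) => (x0, q.1.1)) := by fun_prop
        have m2 : Measurable (fun q : ((Fin n → ℝ) × ℝ) × (Fin n → ℝ) =>
          (r * x0 + s * q.1.2, r • q.1.1 + s • q.2)) := by fun_prop
        exact ((hu.comp (hc.comp m1)).pow_const a).mul ((hw.comp (hc.comp m2)).pow_const b)
      exact h3.lintegral_prod_right'.aemeasurable

/-- duality -/
lemma dual_bound {α : Type*} [MeasurableSpace α] (μ : Measure α) [IsProbabilityMeasure μ]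
    (H : α → ℝ≥0∞) (hH : Measurable H) (q b : ℝ) (hq : 1 < q) (hb : b = 1 - 1 / q) (M : ℝ≥0∞)
    (h : ∀ g : α → ℝ≥0∞, Measurable g → ∫⁻ x, g x ^ b * H x ∂μ ≤ (∫⁻ x, g x ∂μ) ^ b * M) :
    (∫⁻ x, H x ^ q ∂μ) ^ (1 / q) ≤ M := by
  have hq0 : 0 < q := by linarith
  have hbq : q * b = q - 1 := by rw [hb]; field_simp
  have step : ∀ n : ℕ, ∫⁻ x, (min (H x) n) ^ q ∂μ ≤ M ^ q := by
    intro n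
    set I := ∫⁻ x, (min (H x) n) ^ q ∂μ with hI
    have hIt : I ≠ ⊤ := by
      have : I ≤ ∫⁻ _, (n : ℝ≥0∞) ^ q ∂μ := by
        refine lintegral_mono fun x => ?_
        simp only
        gcongr
        exact min_le_right _ _
      refine (this.trans_lt ?_).ne
      simp only [lintegral_const, measure_univ, mul_one]
      exact (ENNReal.rpow_ne_top_of_nonneg hq0.le (ENNReal.natCast_ne_top n)).lt_top
    by_cases hI0 : I = 0
    · rw [hI0]; exact zero_le
    have h1 : I ≤ I ^ b * M := by
      refine le_trans ?_ (h (fun x => (min (H x) n) ^ q) (by fun_prop))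
      refine lintegral_mono fun x => ?_
      simp only
      rw [← ENNReal.rpow_mul, hbq]
      have hm : min (H x) n ≠ ⊤ := ((min_le_right _ _).trans_lt (ENNReal.natCast_lt_top n)).ne
      calc (min (H x) n) ^ q = (min (H x) n) ^ ((q - 1) + 1) := by ring_nf
        _ = (min (H x) n) ^ (q - 1) * (min (H x) n) := by
            rw [ENNReal.rpow_add_of_nonneg _ _ (by linarith) zero_le_one, ENNReal.rpow_one]
        _ ≤ _ := by gcongr; exact min_le_left _ _
    have h2 : I ^ (1 / q) ≤ M := by
      have e : I = I ^ b * I ^ (1 / q) := by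
        rw [← ENNReal.rpow_add _ _ hI0 hIt, hb]; simp
      have hb0 : I ^ b ≠ 0 := by
        simp [ENNReal.rpow_eq_zero_iff, hI0, hIt]
      have hbt : I ^ b ≠ ⊤ := by
        simp [ENNReal.rpow_eq_top_iff, hI0, hIt]
      rw [← ENNReal.mul_le_mul_iff_right hb0 hbt, ← e]
      exact h1
    calc I = (I ^ (1 / q)) ^ q := by
          rw [← ENNReal.rpow_mul, one_div, inv_mul_cancel₀ hq0.ne', ENNReal.rpow_one]
      _ ≤ M ^ q := by gcongr
  have h3 : ∫⁻ x, H x ^ q ∂μ ≤ M ^ q := by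
    have e : ∀ x, H x ^ q = ⨆ n : ℕ, (min (H x) n) ^ q := fun x => (iSup_min_rpow (H x) hq0).symm
    simp_rw [e]
    rw [lintegral_iSup (fun n => by fun_prop) (fun m n hmn x => by simp only; gcongr)]
    exact iSup_le step
  calc (∫⁻ x, H x ^ q ∂μ) ^ (1 / q) ≤ (M ^ q) ^ (1 / q) := by gcongr
    _ = M := by rw [← ENNReal.rpow_mul, mul_one_div_cancel hq0.ne', ENNReal.rpow_one]

theorem stmt8
    (n : ℕ) (hn : 0 < n) (p q t : ℝ) (hp : 1 < p) (hq : 1 < q) (ht : 0 ≤ t)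
    (hpq : Real.exp (-2 * t) ≤ (p - 1) / (q - 1))
    (f : (Fin n → ℝ) → ℝ) (hf : Measurable f) :
    eLpNorm (ouSemigroup n t f) (ENNReal.ofReal q) (stdGaussian (Fin n))
      ≤ eLpNorm f (ENNReal.ofReal p) (stdGaussian (Fin n)) := by
  have hp0 : 0 < p := by linarith
  have hq0 : 0 < q := by linarith
  rcases ht.eq_or_lt with rfl | ht
  · have e : ouSemigroup n 0 f = f := by
      ext x
      simp [ouSemigroup]
    rw [e]
    have hqp : q ≤ p := by
      rw [le_div_iff₀ (by linarith)] at hpq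
      simp at hpq
      linarith
    exact eLpNorm_le_eLpNorm_of_exponent_le (ENNReal.ofReal_le_ofReal hqp)
      hf.aestronglyMeasurable
  set r := Real.exp (-t) with hr
  have hr2 : Real.exp (-2 * t) = r ^ 2 := by
    rw [hr, ← Real.exp_nat_mul]; congr 1; push_cast; ring
  have hlt : r ^ 2 < 1 := by
    rw [← hr2, Real.exp_lt_one_iff]; linarith
  set s := √(1 - Real.exp (-2 * t)) with hs
  have hs2 : s ^ 2 = 1 - r ^ 2 := by
    rw [hs, Real.sq_sqrt (by rw [hr2]; linarith), hr2]
  have hs0 : s ≠ 0 := by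
    intro h
    rw [h] at hs2
    norm_num at hs2
    linarith
  set a := 1 / p with ha
  set b := 1 - 1 / q with hb
  have ha0 : 0 < a := by positivity
  have ha1 : a < 1 := by rw [ha, div_lt_one hp0]; exact hp
  have hb1 : b < 1 := by rw [hb]; have : 0 < 1 / q := by positivity
                         linarith
  have hb0 : 0 < b := by rw [hb]; have : 1 / q < 1 := by rw [div_lt_one hq0]; exact hq
                         linarith
  have hab : r ^ 2 * (a * b) ≤ (1 - a) * (1 - b) := by
    rw [hr2, le_div_iff₀ (by linarith)] at hpq
    have e1 : r ^ 2 * (a * b) = (r ^ 2 * (q - 1)) / (p * q) := by rw [ha, hb]; field_simp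
    have e2 : (1 - a) * (1 - b) = (p - 1) / (p * q) := by rw [ha, hb]; field_simp; ring
    rw [e1, e2]
    gcongr
  have hab' : r ^ 2 * (b * a) ≤ (1 - b) * (1 - a) := by linarith
  set μ := stdGaussian (Fin n) with hμ
  set H : (Fin n → ℝ) → ℝ≥0∞ := fun x => ∫⁻ y, ‖f (r • x + s • y)‖ₑ ∂μ with hH
  have hHm : Measurable H :=
    Measurable.lintegral_prod_right' (f := fun z : (Fin n → ℝ) × (Fin n → ℝ) =>
      ‖f (r • z.1 + s • z.2)‖ₑ) (by fun_prop)
  have hPH : ∀ x, ‖ouSemigroup n t f x‖ₑ ≤ H x := fun x => enorm_integral_le_lintegral_enorm _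
  have hdual := dual_bound μ H hHm q b hq hb ((∫⁻ x, ‖f x‖ₑ ^ p ∂μ) ^ a) (by
    intro g hg
    refine le_trans (le_of_eq ?_) (n_dim hb0 hb1 ha0 ha1 hs0 (by linarith) hab' n g
      (fun x => ‖f x‖ₑ ^ p) hg (by fun_prop))
    refine lintegral_congr fun x => ?_
    rw [hH, ← lintegral_const_mul _ (by fun_prop)]
    refine lintegral_congr fun y => ?_
    rw [← ENNReal.rpow_mul, ha, mul_one_div_cancel hp0.ne', ENNReal.rpow_one])
  rw [eLpNorm_eq_lintegral_rpow_enorm_toReal (by simpa using hq0) ENNReal.ofReal_ne_top,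
    eLpNorm_eq_lintegral_rpow_enorm_toReal (by simpa using hp0) ENNReal.ofReal_ne_top,
    ENNReal.toReal_ofReal hq0.le, ENNReal.toReal_ofReal hp0.le]
  refine le_trans ?_ hdual
  gcongr with x
  exact hPH x
end

section
/- Let n, m, n₁,…,n_m ≤ n be positive integers and p₁,…,p_m real numbers with ∑_{i=1}^m nᵢ/pᵢ = n. For each i let Uᵢ be an nᵢ×n real matrix of rank nᵢ, set N = ∑nᵢ, let U be the N×n matrix with block rows U₁,…,U_m, let B be an n×n real symmetric positive definite matrix, and set P = diag(p₁I_{n₁},…,p_mI_{n_m}) and D_{UBU*} = diag(U₁BU₁*,…,U_mBU_m*). If UBU* ≤ P·D_{UBU*}, then for all nonnegative fᵢ ∈ L_{pᵢ}(ℝ^{nᵢ}), ∫_{ℝⁿ} ∏_{i=1}^m fᵢ(Uᵢx) dx ≤ ( det(B) / ∏_{i=1}^m det(UᵢBUᵢ*)^{1/pᵢ} )^{1/2} · ∏_{i=1}^m ‖fᵢ‖_{pᵢ}. Moreover, equality holds when fᵢ(xᵢ) = exp(−pᵢ⁻¹⟨(UᵢBUᵢ*)⁻¹xᵢ, xᵢ⟩)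 for each i. -/
open MeasureTheory Matrix
open scoped ENNReal


namespace BL

lemma log_bound {d : ℝ} (hd : -1 < d) : Real.log (1 + d) ≤ d - d ^ 2 / 2 + d ^ 3 / 3 := by
  have key : ∀ x : ℝ, -1 < x → HasDerivAt
      (fun x : ℝ => x - x ^ 2 / 2 + x ^ 3 / 3 - Real.log (1 + x)) (x ^ 3 / (1 + x)) x := by
    intro x hx
    have h1 : (1 + x) ≠ 0 := by linarith
    have h := ((((hasDerivAt_id x).sub (((hasDerivAt_id x).pow 2).div_const 2)).add
      (((hasDerivAt_id x).pow 3).div_const 3)).sub (((hasDerivAt_id x).const_add 1).log h1))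
    refine HasDerivAt.congr_deriv (show HasDerivAt _ _ x from h) ?_
    simp only [id]
    push_cast
    field_simp
    ring
  rcases le_total 0 d with h0 | h0
  · have hm : MonotoneOn (fun x : ℝ => x - x ^ 2 / 2 + x ^ 3 / 3 - Real.log (1 + x))
        (Set.Ici 0) := by
      apply monotoneOn_of_deriv_nonneg (convex_Ici 0)
      · intro x hx
        have : (0:ℝ) ≤ x := hx
        exact (key x (by linarith)).continuousAt.continuousWithinAt
      · intro x hx
        simp at hx
        exact (key x (by linarith)).differentiableAt.differentiableWithinAt
      · intro x hx
        simp at hx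
        rw [(key x (by linarith)).deriv]
        positivity
    have := hm (by simp : (0:ℝ) ∈ Set.Ici 0) h0 h0
    simp at this
    linarith
  · have hm : AntitoneOn (fun x : ℝ => x - x ^ 2 / 2 + x ^ 3 / 3 - Real.log (1 + x))
        (Set.Ioc (-1) 0) := by
      apply antitoneOn_of_deriv_nonpos (convex_Ioc _ _)
      · intro x hx
        exact (key x hx.1).continuousAt.continuousWithinAt
      · intro x hx
        simp at hx
        exact (key x (by linarith)).differentiableAt.differentiableWithinAt
      · intro x hx
        simp at hx
        rw [(key x (by linarith)).deriv]
        apply div_nonpos_of_nonpos_of_nonneg _ (by linarith)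
        have : x ^ 3 = x * x ^ 2 := by ring
        rw [this]
        exact mul_nonpos_of_nonpos_of_nonneg hx.2.le (sq_nonneg x)
    have := hm (⟨hd, h0⟩ : d ∈ Set.Ioc (-1:ℝ) 0) (by simp : (0:ℝ) ∈ Set.Ioc (-1:ℝ) 0) h0
    simp at this
    linarith

lemma exp_bound3 (s : ℝ) : Real.exp s ≤ 1 + s + s ^ 2 / 2 + |s| ^ 3 * Real.exp |s| := by
  have h := Complex.norm_exp_sub_sum_le_norm_mul_exp (s : ℂ) 3
  have h2 : (Complex.exp (s:ℂ) - ∑ m ∈ Finset.range 3, (s:ℂ) ^ m / (m.factorial : ℂ))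
      = ((Real.exp s - (1 + s + s ^ 2 / 2) : ℝ) : ℂ) := by
    simp [Finset.sum_range_succ]
  rw [h2, Complex.norm_real, Complex.norm_real, Real.norm_eq_abs, Real.norm_eq_abs] at h
  have := le_abs_self (Real.exp s - (1 + s + s ^ 2 / 2))
  linarith

variable {ι : Type*} [Fintype ι]

lemma pw1 (c : ι → ℝ) (hc0 : ∀ i, 0 ≤ c i) (hc1 : ∀ i, c i ≤ 1) (K : ℝ) :
    ∃ C : ℝ, 0 ≤ C ∧ ∀ d : ι → ℝ, (∀ i, -1 < d i) → (∑ i, |d i|) ≤ K →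
      ∏ i, (1 + d i) ^ c i ≤ 1 + ∑ i, c i * d i
        + ((∑ i, c i * d i) ^ 2 - ∑ i, c i * d i ^ 2) / 2 + C * (∑ i, |d i|) ^ 3 := by
  set Q : ℝ := 1 + |K| + |K| ^ 2 with hQ
  refine ⟨1 + Q ^ 2 + Q ^ 3 * Real.exp (Q * |K|), by positivity, fun d hd hD => ?_⟩
  set D := ∑ i, |d i| with hDdef
  have hD0 : 0 ≤ D := Finset.sum_nonneg fun i _ => abs_nonneg _
  have hDK : D ≤ |K| := hD.trans (le_abs_self K)
  have hdi : ∀ i, |d i| ≤ D := fun i =>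
    Finset.single_le_sum (f := fun i => |d i|) (fun i _ => abs_nonneg _) (Finset.mem_univ i)
  set a := ∑ i, c i * d i with ha
  set q := ∑ i, c i * d i ^ 2 with hq
  set r := ∑ i, c i * d i ^ 3 / 3 with hr
  have haD : |a| ≤ D := by
    refine (Finset.abs_sum_le_sum_abs _ _).trans (Finset.sum_le_sum fun i _ => ?_)
    rw [abs_mul, abs_of_nonneg (hc0 i)]
    exact mul_le_of_le_one_left (abs_nonneg _) (hc1 i)
  have hqD : q ≤ D ^ 2 := by
    have : q ≤ ∑ i, |d i| * D := by
      refine Finset.sum_le_sum fun i _ => ?_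
      have h1 : c i * d i ^ 2 ≤ d i ^ 2 := mul_le_of_le_one_left (sq_nonneg _) (hc1 i)
      have h2 : d i ^ 2 = |d i| * |d i| := by rw [← sq, sq_abs]
      have h3 := mul_le_mul_of_nonneg_left (hdi i) (abs_nonneg (d i))
      linarith
    rw [← Finset.sum_mul] at this
    linarith [sq D]
  have hq0 : 0 ≤ q := Finset.sum_nonneg fun i _ => mul_nonneg (hc0 i) (sq_nonneg _)
  have hrD : |r| ≤ D ^ 3 := by
    have : |r| ≤ ∑ i, |d i| * D ^ 2 := by
      refine (Finset.abs_sum_le_sum_abs _ _).trans (Finset.sum_le_sum fun i _ => ?_)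
      rw [abs_div, abs_mul, abs_of_nonneg (hc0 i), abs_pow]
      have h1 : c i * |d i| ^ 3 ≤ |d i| ^ 3 := mul_le_of_le_one_left (by positivity) (hc1 i)
      have h2 : |d i| ^ 2 ≤ D ^ 2 := by gcongr; exact hdi i
      have h3 := mul_le_mul_of_nonneg_left h2 (abs_nonneg (d i))
      have h4 : |d i| ^ 3 = |d i| * |d i| ^ 2 := by ring
      have h5 : (0:ℝ) ≤ c i * |d i| ^ 3 := mul_nonneg (hc0 i) (by positivity)
      have h6 : |(3:ℝ)| = 3 := by norm_num
      rw [h6]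
      linarith
    rw [← Finset.sum_mul] at this
    calc |r| ≤ D * D ^ 2 := this
      _ = D ^ 3 := by ring
  set s := a - q / 2 + r with hs
  have hprod : ∏ i, (1 + d i) ^ c i ≤ Real.exp s := by
    have : Real.exp s = ∏ i, Real.exp (c i * (d i - d i ^ 2 / 2 + d i ^ 3 / 3)) := by
      rw [← Real.exp_sum, hs, ha, hq, hr, Finset.sum_div, ← Finset.sum_sub_distrib,
        ← Finset.sum_add_distrib]
      congr 1
      refine Finset.sum_congr rfl fun i _ => by ring
    rw [this]
    refine Finset.prod_le_prod (fun i _ => Real.rpow_nonneg (by linarith [hd i]) _) fun i _ => ?_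
    rw [Real.rpow_def_of_pos (by linarith [hd i])]
    apply Real.exp_le_exp.2
    rw [mul_comm]
    exact mul_le_mul_of_nonneg_left (log_bound (hd i)) (hc0 i)
  refine hprod.trans ((exp_bound3 s).trans ?_)
  have hD2 : D ^ 2 ≤ |K| * D := by nlinarith
  have hD3 : D ^ 3 ≤ |K| ^ 2 * D := by
    have : D ^ 2 ≤ |K| ^ 2 := by gcongr
    nlinarith
  have hD3' : D ^ 3 ≤ |K| * D ^ 2 := by nlinarith [sq_nonneg D]
  have a1 := abs_le.1 haD
  have r1 := abs_le.1 hrD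
  have hsQ : |s| ≤ Q * D := by
    rw [abs_le]
    constructor <;> rw [hQ, hs] <;> nlinarith
  have hsa : |s - a| ≤ Q * D ^ 2 := by
    rw [abs_le]
    have : 0 ≤ |K| ^ 2 * D ^ 2 := by positivity
    have : 0 ≤ |K| * D ^ 2 := by positivity
    constructor <;> rw [hQ, hs] <;> nlinarith
  have hQ1 : 1 ≤ Q := by rw [hQ]; nlinarith [abs_nonneg K]
  have hsa' : |s + a| ≤ 2 * (Q * D) := by
    have := abs_add_le s a
    nlinarith
  have hs2 : s ^ 2 ≤ a ^ 2 + 2 * Q ^ 2 * D ^ 3 := by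
    have h1 : s ^ 2 - a ^ 2 = (s - a) * (s + a) := by ring
    have h2 : (s - a) * (s + a) ≤ |s - a| * |s + a| := by
      rw [← abs_mul]; exact le_abs_self _
    have h3 : |s - a| * |s + a| ≤ (Q * D ^ 2) * (2 * (Q * D)) := by gcongr
    nlinarith
  have hs3 : |s| ^ 3 * Real.exp |s| ≤ Q ^ 3 * Real.exp (Q * |K|) * D ^ 3 := by
    have h1 : |s| ^ 3 ≤ (Q * D) ^ 3 := by gcongr
    have h2 : |s| ≤ Q * |K| := hsQ.trans (by gcongr)
    calc |s| ^ 3 * Real.exp |s| ≤ (Q * D) ^ 3 * Real.exp (Q * |K|) := by gcongr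
      _ = _ := by ring
  have e1 : (1 + Q ^ 2 + Q ^ 3 * Real.exp (Q * |K|)) * D ^ 3
    = D ^ 3 + Q ^ 2 * D ^ 3 + Q ^ 3 * Real.exp (Q * |K|) * D ^ 3 := by ring
  rw [e1]
  linarith

lemma pw2 (c : ι → ℝ) (hc0 : ∀ i, 0 ≤ c i) (hc1 : ∀ i, c i ≤ 1) (K R : ℝ) (hR : 0 ≤ R) :
    ∃ C : ℝ, 0 ≤ C ∧ ∀ (h Z : ℝ) (d l ρ : ι → ℝ), 0 ≤ h → h ≤ 1 → 1 ≤ Z →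
      (∀ i, -1 < d i) → (∀ i, |d i| ≤ K) → (∀ i, d i = h * l i + ρ i) →
      (∀ i, |l i| ≤ R * Z) → (∀ i, |ρ i| ≤ R * h ^ 2 * Z) →
      ∏ i, (1 + d i) ^ c i ≤ 1 + ∑ i, c i * d i
        + h ^ 2 * ((∑ i, c i * l i) ^ 2 - ∑ i, c i * l i ^ 2) / 2 + C * h ^ 3 * Z ^ 3 := by
  obtain ⟨C1, hC1, H⟩ := pw1 c hc0 hc1 (Fintype.card ι * K)
  set m : ℝ := ((Fintype.card ι : ℕ) : ℝ) with hm
  have hm0 : 0 ≤ m := by positivity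
  refine ⟨C1 * (m * (2 * R)) ^ 3 + (3 * m ^ 2 + 2 * m) * R ^ 2, by positivity, ?_⟩
  intro h Z d l ρ h0 h1 hZ hd hdK hdl hl hρ
  have hsumc : ∀ b : ℝ, ∑ _i : ι, b = m * b := by intro b; simp [hm]
  have hD : ∑ i, |d i| ≤ m * K := by
    rw [← hsumc]; exact Finset.sum_le_sum fun i _ => hdK i
  have hmain := H d hd hD
  have hZ0 : 0 ≤ Z := by linarith
  have hD' : ∑ i, |d i| ≤ m * (2 * R) * (h * Z) := by
    have : ∑ i, |d i| ≤ ∑ _i : ι, (2 * R) * (h * Z) := by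
      refine Finset.sum_le_sum fun i _ => ?_
      rw [hdl i]
      have e1 := abs_add_le (h * l i) (ρ i)
      rw [abs_mul, abs_of_nonneg h0] at e1
      have e2 := mul_le_mul_of_nonneg_left (hl i) h0
      have e3 : R * h ^ 2 * Z ≤ R * h * Z := by
        have : h ^ 2 ≤ h := by nlinarith
        gcongr
      have := hρ i
      nlinarith
    rw [hsumc] at this
    linarith
  have hD0 : 0 ≤ ∑ i, |d i| := Finset.sum_nonneg fun i _ => abs_nonneg _
  have hD3 : (∑ i, |d i|) ^ 3 ≤ (m * (2 * R)) ^ 3 * (h ^ 3 * Z ^ 3) := by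
    calc _ ≤ (m * (2 * R) * (h * Z)) ^ 3 := by gcongr
      _ = _ := by ring
  set A := ∑ i, c i * l i with hA
  set P := ∑ i, c i * ρ i with hP
  have hAP : ∑ i, c i * d i = h * A + P := by
    rw [hA, hP, Finset.mul_sum, ← Finset.sum_add_distrib]
    exact Finset.sum_congr rfl fun i _ => by rw [hdl i]; ring
  have hAb : |A| ≤ m * (R * Z) := by
    rw [← hsumc]
    refine (Finset.abs_sum_le_sum_abs _ _).trans (Finset.sum_le_sum fun i _ => ?_)
    rw [abs_mul, abs_of_nonneg (hc0 i)]
    exact (mul_le_of_le_one_left (abs_nonneg _) (hc1 i)).trans (hl i)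
  have hPb : |P| ≤ m * (R * h ^ 2 * Z) := by
    rw [← hsumc]
    refine (Finset.abs_sum_le_sum_abs _ _).trans (Finset.sum_le_sum fun i _ => ?_)
    rw [abs_mul, abs_of_nonneg (hc0 i)]
    exact (mul_le_of_le_one_left (abs_nonneg _) (hc1 i)).trans (hρ i)
  have hX : -∑ i, c i * d i ^ 2 ≤ - (h ^ 2 * ∑ i, c i * l i ^ 2) + 2 * m * (R ^ 2 * h ^ 3 * Z ^ 2) := by
    have : ∑ i, (h ^ 2 * (c i * l i ^ 2) - c i * d i ^ 2) ≤ ∑ _i : ι, 2 * (R ^ 2 * h ^ 3 * Z ^ 2) := by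
      refine Finset.sum_le_sum fun i _ => ?_
      have e0 : h ^ 2 * (c i * l i ^ 2) - c i * d i ^ 2
        = c i * (-(2 * (h * (l i * ρ i))) - ρ i ^ 2) := by rw [hdl i]; ring
      have e1 : -(l i * ρ i) ≤ (R * Z) * (R * h ^ 2 * Z) := by
        refine (neg_le_abs _).trans ?_
        rw [abs_mul]
        exact mul_le_mul (hl i) (hρ i) (abs_nonneg _) (by positivity)
      have e2 := mul_le_mul_of_nonneg_left e1 h0
      have e3 : -(2 * (h * (l i * ρ i))) - ρ i ^ 2 ≤ 2 * (R ^ 2 * h ^ 3 * Z ^ 2) := by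
        nlinarith [sq_nonneg (ρ i)]
      rw [e0]
      have e4 : 0 ≤ 2 * (R ^ 2 * h ^ 3 * Z ^ 2) := by positivity
      exact (mul_le_mul_of_nonneg_left e3 (hc0 i)).trans (mul_le_of_le_one_left e4 (hc1 i))
    rw [Finset.sum_sub_distrib, ← Finset.mul_sum, hsumc] at this
    linarith
  have hY : (h * A + P) ^ 2 ≤ h ^ 2 * A ^ 2 + 3 * m ^ 2 * (R ^ 2 * h ^ 3 * Z ^ 2) := by
    have e1 : A * P ≤ (m * (R * Z)) * (m * (R * h ^ 2 * Z)) := by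
      refine (le_abs_self _).trans ?_
      rw [abs_mul]
      exact mul_le_mul hAb hPb (abs_nonneg _) (by positivity)
    have e2 := mul_le_mul_of_nonneg_left e1 h0
    have e3 : P ^ 2 ≤ (m * (R * h ^ 2 * Z)) ^ 2 := by
      rw [← sq_abs P]; gcongr
    have e4 : (m * (R * h ^ 2 * Z)) ^ 2 ≤ m ^ 2 * (R ^ 2 * h ^ 3 * Z ^ 2) := by
      have : (m * (R * h ^ 2 * Z)) ^ 2 = h * (m ^ 2 * (R ^ 2 * h ^ 3 * Z ^ 2)) := by ring
      rw [this]
      exact mul_le_of_le_one_left (by positivity) h1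
    nlinarith
  have hZ23 : R ^ 2 * h ^ 3 * Z ^ 2 ≤ R ^ 2 * h ^ 3 * Z ^ 3 := by
    have : Z ^ 2 ≤ Z ^ 3 := by nlinarith [sq_nonneg Z]
    gcongr
  have hfin : (3 * m ^ 2 + 2 * m) * (R ^ 2 * h ^ 3 * Z ^ 2) ≤
      (3 * m ^ 2 + 2 * m) * (R ^ 2 * h ^ 3 * Z ^ 3) := by gcongr
  have hfin0 : 0 ≤ (3 * m ^ 2 + 2 * m) * (R ^ 2 * h ^ 3 * Z ^ 2) := by positivity
  have hCD := mul_le_mul_of_nonneg_left hD3 hC1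
  have e1 : (C1 * (m * (2 * R)) ^ 3 + (3 * m ^ 2 + 2 * m) * R ^ 2) * h ^ 3 * Z ^ 3
    = C1 * ((m * (2 * R)) ^ 3 * (h ^ 3 * Z ^ 3)) + (3 * m ^ 2 + 2 * m) * (R ^ 2 * h ^ 3 * Z ^ 3) := by
    ring
  rw [e1]
  rw [hAP] at hmain ⊢
  linarith

end BL
namespace BL
open ProbabilityTheory

set_option linter.unusedSectionVars false

variable {E : Type*} [NormedAddCommGroup E] [InnerProductSpace ℝ E] [FiniteDimensional ℝ E]
  [MeasurableSpace E] [BorelSpace E]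

/-- bounded below and above, with a bounded gradient in `W` and a quadratic Taylor bound -/
structure Nice (W : Submodule ℝ E) (a M L : ℝ) (F : E → ℝ) (v : E → E) : Prop where
  measF : Measurable F
  measv : Measurable v
  lb : ∀ x, a ≤ F x
  ub : ∀ x, F x ≤ M
  vb : ∀ x, ‖v x‖ ≤ L
  vW : ∀ x, v x ∈ W
  tay : ∀ x y, |F (x + y) - F x - inner ℝ (v x) y| ≤ L * ‖y‖ ^ 2

lemma bdd_int {μ : Measure E} [IsFiniteMeasure μ] {φ : E → ℝ} (hφ : Measurable φ) {C : ℝ}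
    (hC : ∀ x, |φ x| ≤ C) : Integrable φ μ :=
  Integrable.of_bound hφ.aestronglyMeasurable C (Filter.Eventually.of_forall hC)

lemma bdd_int_shift {φ : E → ℝ} (hφ : Measurable φ) {C : ℝ}
    (hC : ∀ x, |φ x| ≤ C) (h : ℝ) (x : E) :
    Integrable (fun y => φ (x + h • y)) (stdGaussian E) :=
  bdd_int (hφ.comp (by fun_prop)) (fun y => hC _)

lemma Nice.abs_le {W : Submodule ℝ E} {a M L : ℝ} {F : E → ℝ} {v : E → E}
    (hF : Nice W a M L F v) (ha : 0 < a) (x : E) : |F x| ≤ M := by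
  rw [abs_of_nonneg (ha.le.trans (hF.lb x))]; exact hF.ub x

lemma Nice.int {W : Submodule ℝ E} {a M L : ℝ} {F : E → ℝ} {v : E → E}
    (hF : Nice W a M L F v) (ha : 0 < a) (h : ℝ) (x : E) :
    Integrable (fun y => F (x + h • y)) (stdGaussian E) :=
  bdd_int_shift hF.measF (hF.abs_le ha) h x

lemma Nice.intv {W : Submodule ℝ E} {a M L : ℝ} {F : E → ℝ} {v : E → E}
    (hF : Nice W a M L F v) (h : ℝ) (x : E) :
    Integrable (fun y => v (x + h • y)) (stdGaussian E) :=
  Integrable.of_bound (hF.measv.comp (by fun_prop)).aestronglyMeasurable L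
    (Filter.Eventually.of_forall fun y => hF.vb _)

lemma Nice.av {W : Submodule ℝ E} {a M L : ℝ} {F : E → ℝ} {v : E → E}
    (hF : Nice W a M L F v) (ha : 0 < a) (h : ℝ) :
    Nice W a M L (fun x => ∫ y, F (x + h • y) ∂(stdGaussian E))
      (fun x => ∫ y, v (x + h • y) ∂(stdGaussian E)) where
  measF := by
    have : StronglyMeasurable (fun p : E × E => F (p.1 + h • p.2)) :=
      (hF.measF.comp (by fun_prop)).stronglyMeasurable
    exact (this.integral_prod_right (ν := stdGaussian E)).measurable
  measv := by
    have : StronglyMeasurable (fun p : E × E => v (p.1 + h • p.2)) :=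
      (hF.measv.comp (by fun_prop)).stronglyMeasurable
    exact (this.integral_prod_right (ν := stdGaussian E)).measurable
  lb x := by
    have := integral_mono (μ := stdGaussian E) (integrable_const a) (hF.int ha h x)
      (fun y => hF.lb _)
    simpa using this
  ub x := by
    have := integral_mono (μ := stdGaussian E) (hF.int ha h x) (integrable_const M)
      (fun y => hF.ub _)
    simpa using this
  vb x := by
    have := norm_integral_le_of_norm_le_const (μ := stdGaussian E)
      (f := fun y => v (x + h • y)) (C := L) (Filter.Eventually.of_forall fun y => hF.vb _)
    simpa using this
  vW x := by
    have := Convex.integral_mem (μ := stdGaussian E) (f := fun y => v (x + h • y))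
      (s := (W : Set E)) W.convex W.closed_of_finiteDimensional
      (Filter.Eventually.of_forall fun y => hF.vW _) (hF.intv h x)
    exact this
  tay x y := by
    have e1 : (∫ z, F (x + y + h • z) ∂(stdGaussian E)) - (∫ z, F (x + h • z) ∂(stdGaussian E))
        - inner ℝ (∫ z, v (x + h • z) ∂(stdGaussian E)) y
        = ∫ z, (F ((x + h • z) + y) - F (x + h • z) - inner ℝ (v (x + h • z)) y)
            ∂(stdGaussian E) := by
      have i1 : Integrable (fun z => F ((x + h • z) + y)) (stdGaussian E) := by
        have := hF.int ha h (x + y)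
        refine this.congr (Filter.Eventually.of_forall fun z => ?_)
        show F _ = F _
        congr 1; abel
      have i2 := hF.int ha h x
      have i3 : Integrable (fun z => inner ℝ (v (x + h • z)) y) (stdGaussian E) :=
        (hF.intv h x).inner_const y
      have i12 : Integrable (fun z => F ((x + h • z) + y) - F (x + h • z)) (stdGaussian E) := i1.sub i2
      rw [integral_sub i12 i3, integral_sub i1 i2]
      congr 1
      · congr 1
        refine integral_congr_ae (Filter.Eventually.of_forall fun z => ?_)
        show F _ = F _
        congr 1; abel
      · rw [real_inner_comm, ← integral_inner (hF.intv h x) y]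
        exact integral_congr_ae (Filter.Eventually.of_forall fun z => real_inner_comm _ _)
    rw [e1]
    have := norm_integral_le_of_norm_le_const (μ := stdGaussian E)
      (f := fun z => (F ((x + h • z) + y) - F (x + h • z) - inner ℝ (v (x + h • z)) y))
      (C := L * ‖y‖ ^ 2) (Filter.Eventually.of_forall fun z => hF.tay _ y)
    simpa using this

lemma rot {φ : E → ℝ} (hφ : Measurable φ) {C : ℝ} (hC : ∀ x, |φ x| ≤ C) (h : ℝ) :
    ∫ y, φ ((Real.sqrt 2 * h) • y) ∂(stdGaussian E)
      = ∫ z, ∫ y, φ (h • z + h • y) ∂(stdGaussian E) ∂(stdGaussian E) := by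
  have h1 := IsGaussian.map_rotation_eq_self (μ := stdGaussian E) (by simp) (Real.pi / 4)
  have h2 : ∫ y, φ ((Real.sqrt 2 * h) • y) ∂(stdGaussian E)
      = ∫ p, φ ((Real.sqrt 2 * h) • p.1) ∂((stdGaussian E).prod (stdGaussian E)) := by
    have : stdGaussian E = ((stdGaussian E).prod (stdGaussian E)).map Prod.fst := by
      simp
    conv_lhs => rw [this]
    have hm : Measurable (fun y => φ ((Real.sqrt 2 * h) • y)) := hφ.comp (by fun_prop)
    rw [integral_map (by fun_prop) hm.aestronglyMeasurable]
  have hm : Measurable (fun p : E × E => φ ((Real.sqrt 2 * h) • p.1)) := hφ.comp (by fun_prop)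
  rw [h2, ← h1, integral_map (by fun_prop) hm.aestronglyMeasurable]
  rw [← integral_prod (f := fun p : E × E => φ (h • p.1 + h • p.2))]
  · refine integral_congr_ae (Filter.Eventually.of_forall fun p => ?_)
    show φ _ = φ _
    congr 1
    simp only [ContinuousLinearMap.rotation_apply, Real.cos_pi_div_four, Real.sin_pi_div_four,
      smul_add, smul_smul]
    have : Real.sqrt 2 * h * (Real.sqrt 2 / 2) = h := by
      have := Real.mul_self_sqrt (show (0:ℝ) ≤ 2 by norm_num)
      linear_combination (h / 2) * this
    rw [this]
  · exact Integrable.of_bound (hφ.comp (by fun_prop)).aestronglyMeasurable C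
      (Filter.Eventually.of_forall fun p => hC _)

variable {ι : Type*} [Fintype ι]

def Hyp (W : ι → Submodule ℝ E) (a M L : ℝ) (c : ι → ℝ) (h κ : ℝ) : Prop :=
  ∀ (F : ι → E → ℝ) (v : ι → E → E), (∀ i, Nice (W i) a M L (F i) (v i)) → ∀ x,
    ∫ y, ∏ i, F i (x + h • y) ^ c i ∂(stdGaussian E)
      ≤ κ * ∏ i, (∫ y, F i (x + h • y) ∂(stdGaussian E)) ^ c i

lemma prod_meas {W : ι → Submodule ℝ E} {a M L : ℝ} {c : ι → ℝ}
    {F : ι → E → ℝ} {v : ι → E → E} (hF : ∀ i, Nice (W i) a M L (F i) (v i)) :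
    Measurable (fun x => ∏ i, F i x ^ c i) :=
  Finset.measurable_prod _ fun i _ => ((hF i).measF.pow_const _)

lemma prod_bdd {W : ι → Submodule ℝ E} {a M L : ℝ} (ha : 0 < a) {c : ι → ℝ} (hc0 : ∀ i, 0 ≤ c i)
    {F : ι → E → ℝ} {v : ι → E → E} (hF : ∀ i, Nice (W i) a M L (F i) (v i)) (x : E) :
    |∏ i, F i x ^ c i| ≤ ∏ i, M ^ c i := by
  have h0 : ∀ i, 0 ≤ F i x := fun i => ha.le.trans ((hF i).lb x)
  rw [abs_of_nonneg (Finset.prod_nonneg fun i _ => Real.rpow_nonneg (h0 i) _)]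
  exact Finset.prod_le_prod (fun i _ => Real.rpow_nonneg (h0 i) _)
    fun i _ => Real.rpow_le_rpow (h0 i) ((hF i).ub x) (hc0 i)

lemma Hyp.double {W : ι → Submodule ℝ E} {a M L : ℝ} (ha : 0 < a) {c : ι → ℝ}
    (hc0 : ∀ i, 0 ≤ c i) {h κ : ℝ} (hκ : 0 ≤ κ) (H : Hyp W a M L c h κ) :
    Hyp W a M L c (Real.sqrt 2 * h) (κ * κ) := by
  intro F v hF x
  have e1 := rot (E := E) (φ := fun w => ∏ i, F i (x + w) ^ c i)
    ((prod_meas hF).comp (measurable_const_add x)) (fun w => prod_bdd ha hc0 hF (x + w)) h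
  have e2 : ∀ i, ∫ y, F i (x + (Real.sqrt 2 * h) • y) ∂(stdGaussian E)
      = ∫ z, ∫ y, F i (x + (h • z + h • y)) ∂(stdGaussian E) ∂(stdGaussian E) := fun i =>
    rot (E := E) (φ := fun w => F i (x + w))
      ((hF i).measF.comp (measurable_const_add x)) (fun w => (hF i).abs_le ha (x + w)) h
  simp only [e1, e2]
  simp only [← add_assoc]
  have hF' := fun i => (hF i).av ha h
  have step2 := H _ _ hF' x
  have step1 : ∫ z, ∫ y, ∏ i, F i (x + h • z + h • y) ^ c i ∂(stdGaussian E) ∂(stdGaussian E)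
      ≤ ∫ z, κ * ∏ i, (∫ y, F i (x + h • z + h • y) ∂(stdGaussian E)) ^ c i ∂(stdGaussian E) := by
    refine integral_mono_of_nonneg (Filter.Eventually.of_forall fun z => ?_) ?_
      (Filter.Eventually.of_forall fun z => H F v hF (x + h • z))
    · exact integral_nonneg fun y => Finset.prod_nonneg fun i _ =>
        Real.rpow_nonneg (ha.le.trans ((hF i).lb _)) _
    · exact (bdd_int_shift (prod_meas hF') (prod_bdd ha hc0 hF') h x).const_mul κ
  refine step1.trans ?_
  rw [integral_const_mul, mul_assoc]
  exact mul_le_mul_of_nonneg_left step2 hκ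

lemma Hyp.limit {W : ι → Submodule ℝ E} {a M L : ℝ} (ha : 0 < a) {c : ι → ℝ}
    (hc0 : ∀ i, 0 ≤ c i) {C : ℝ} (hC : 0 ≤ C)
    (H : ∀ h, 0 ≤ h → h ≤ 1 → Hyp W a M L c h (1 + C * h ^ 3)) :
    Hyp W a M L c 1 1 := by
  set s : ℝ := Real.sqrt 2 with hs
  have hs2 : s ^ 2 = 2 := Real.sq_sqrt (by norm_num)
  have hs1 : 1 < s := by
    rw [hs]; exact Real.lt_sqrt_of_sq_lt (by norm_num)
  have hs0 : 0 < s := by linarith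
  have key : ∀ (k : ℕ) (h κ : ℝ), 0 ≤ κ → Hyp W a M L c h κ →
      Hyp W a M L c (s ^ k * h) (κ ^ (2 ^ k)) := by
    intro k
    induction k with
    | zero => intro h κ hκ H; simpa using H
    | succ k ih =>
      intro h κ hκ H
      have := (ih h κ hκ H).double ha hc0 (by positivity)
      convert this using 1
      · rw [← hs]; ring
      · ring
  intro F v hF x
  have hk : ∀ k : ℕ, ∫ y, ∏ i, F i (x + (1:ℝ) • y) ^ c i ∂(stdGaussian E)
      ≤ Real.exp (C * s⁻¹ ^ k) * ∏ i, (∫ y, F i (x + (1:ℝ) • y) ∂(stdGaussian E)) ^ c i := by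
    intro k
    have hh0 : (0:ℝ) ≤ s⁻¹ ^ k := by positivity
    have hh1 : s⁻¹ ^ k ≤ 1 := pow_le_one₀ (by positivity) (inv_le_one_of_one_le₀ hs1.le)
    have h3 := key k _ _ (by positivity) (H _ hh0 hh1)
    have e : s ^ k * s⁻¹ ^ k = 1 := by rw [← mul_pow, mul_inv_cancel₀ hs0.ne', one_pow]
    rw [e] at h3
    refine (h3 F v hF x).trans ?_
    refine mul_le_mul_of_nonneg_right ?_ (Finset.prod_nonneg fun i _ => Real.rpow_nonneg
      (integral_nonneg fun y => ha.le.trans ((hF i).lb _)) _)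
    have e2 : (2:ℝ) ^ k * (C * (s⁻¹ ^ k) ^ 3) = C * s⁻¹ ^ k := by
      have : (2:ℝ) ^ k = (s ^ k) ^ 2 := by rw [← hs2]; ring
      rw [this]
      calc (s ^ k) ^ 2 * (C * (s⁻¹ ^ k) ^ 3) = C * s⁻¹ ^ k * (s ^ k * s⁻¹ ^ k) ^ 2 := by ring
        _ = _ := by rw [e]; ring
    calc (1 + C * (s⁻¹ ^ k) ^ 3) ^ (2 ^ k) ≤ (Real.exp (C * (s⁻¹ ^ k) ^ 3)) ^ (2 ^ k) := by
          gcongr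
          linarith [Real.add_one_le_exp (C * (s⁻¹ ^ k) ^ 3)]
      _ = Real.exp (C * s⁻¹ ^ k) := by
          rw [← Real.exp_nat_mul]; push_cast; rw [e2]
  refine ge_of_tendsto' (f := fun k : ℕ => Real.exp (C * s⁻¹ ^ k) *
    ∏ i, (∫ y, F i (x + (1:ℝ) • y) ∂(stdGaussian E)) ^ c i) (x := Filter.atTop) ?_ hk
  refine Filter.Tendsto.mul_const _ ?_
  have : Filter.Tendsto (fun k : ℕ => C * s⁻¹ ^ k) Filter.atTop (nhds (C * 0)) :=
    (tendsto_pow_atTop_nhds_zero_of_lt_one (by positivity) (inv_lt_one_of_one_lt₀ hs1)).const_mul C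
  have h2 := (Real.continuous_exp.tendsto _).comp this
  simpa [Function.comp_def] using h2

end BL
namespace BL
open ProbabilityTheory

set_option linter.unusedSectionVars false

variable {E : Type*} [NormedAddCommGroup E] [InnerProductSpace ℝ E] [FiniteDimensional ℝ E]
  [MeasurableSpace E] [BorelSpace E]

lemma mean_inner (w : E) : ∫ y, inner ℝ w y ∂(stdGaussian E) = 0 :=
  integral_strongDual_stdGaussian (innerSL ℝ w)

lemma int_inner (w : E) : Integrable (fun y => inner ℝ w y) (stdGaussian E) :=
  IsGaussian.integrable_dual (stdGaussian E) (innerSL ℝ w)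

lemma int_inner_sq (w : E) : Integrable (fun y => (inner ℝ w y) ^ 2) (stdGaussian E) :=
  (IsGaussian.memLp_dual (stdGaussian E) (innerSL ℝ w) 2 (by norm_num)).integrable_sq

lemma var_inner (w : E) : ∫ y, (inner ℝ w y) ^ 2 ∂(stdGaussian E) = ‖w‖ ^ 2 := by
  have h := variance_dual_stdGaussian (innerSL ℝ w)
  rw [variance_of_integral_eq_zero (by fun_prop) (integral_strongDual_stdGaussian _)] at h
  simpa using h

lemma int_pow (k : ℕ) : Integrable (fun y => ‖y‖ ^ k) (stdGaussian E) := by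
  rcases Nat.eq_zero_or_pos k with rfl | hk
  · simp
  · have := (IsGaussian.memLp_id (stdGaussian E) (k : ℝ≥0∞) (by simp)).integrable_norm_pow hk.ne'
    simpa using this

lemma int_Z (b : ℝ) : Integrable (fun y => (‖y‖ ^ 2 + b) ^ 3) (stdGaussian E) := by
  have : (fun y : E => (‖y‖ ^ 2 + b) ^ 3) =
      fun y => ‖y‖ ^ 6 + 3 * b * ‖y‖ ^ 4 + 3 * b ^ 2 * ‖y‖ ^ 2 + b ^ 3 := by
    funext y; ring
  rw [this]
  exact (((int_pow 6).add ((int_pow 4).const_mul _)).add ((int_pow 2).const_mul _)).add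
    (integrable_const _)

variable {ι : Type*} [Fintype ι]

lemma one_step {W : ι → Submodule ℝ E} {a M L : ℝ} (ha : 0 < a) (hM : a ≤ M) (hL : 0 ≤ L)
    {c : ι → ℝ} (hc0 : ∀ i, 0 ≤ c i) (hc1 : ∀ i, c i ≤ 1)
    (hW : ∀ w : ι → E, (∀ i, w i ∈ W i) → ‖∑ i, c i • w i‖ ^ 2 ≤ ∑ i, c i * ‖w i‖ ^ 2) :
    ∃ C, 0 ≤ C ∧ ∀ h, 0 ≤ h → h ≤ 1 → Hyp W a M L c h (1 + C * h ^ 3) := by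
  obtain ⟨C1, hC1, H⟩ := pw2 c hc0 hc1 (M / a + 1) (L / a) (by positivity)
  set m2 := ∫ y, ‖y‖ ^ 2 ∂(stdGaussian E) with hm2
  have hm20 : 0 ≤ m2 := integral_nonneg fun y => by positivity
  set Z : E → ℝ := fun y => ‖y‖ ^ 2 + (1 + m2) with hZ
  have hZint : Integrable (fun y => Z y ^ 3) (stdGaussian E) := int_Z _
  have hZ1 : ∀ y, 1 ≤ Z y := fun y => by simp only [hZ]; nlinarith [sq_nonneg ‖y‖]
  refine ⟨C1 * ∫ y, Z y ^ 3 ∂(stdGaussian E), mul_nonneg hC1 (integral_nonneg fun y => by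
    have := hZ1 y
    positivity), ?_⟩
  intro h h0 h1 F v hF x
  set A : ι → ℝ := fun i => ∫ y, F i (x + h • y) ∂(stdGaussian E) with hA
  have hAa : ∀ i, a ≤ A i := fun i => ((hF i).av ha h).lb x
  have hA0 : ∀ i, 0 < A i := fun i => ha.trans_le (hAa i)
  set d : ι → E → ℝ := fun i y => F i (x + h • y) / A i - 1 with hd
  set w : ι → E := fun i => (A i)⁻¹ • v i x with hw
  have hdint : ∀ i, Integrable (d i) (stdGaussian E) := fun i =>
    (((hF i).int ha h x).div_const _).sub (integrable_const _)
  have hdmean : ∀ i, ∫ y, d i y ∂(stdGaussian E) = 0 := by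
    intro i
    simp only [hd]
    rw [integral_sub (((hF i).int ha h x).div_const _) (integrable_const _), integral_div]
    simp only [integral_const, probReal_univ, smul_eq_mul, mul_one]
    rw [show (∫ y, F i (x + h • y) ∂(stdGaussian E)) = A i from rfl, div_self (hA0 i).ne', sub_self]
  -- bound of the mean
  have hmean : ∀ i, |A i - F i x| ≤ L * h ^ 2 * m2 := by
    intro i
    have i1 := (hF i).int ha h x
    have i2 : Integrable (fun y => inner ℝ (v i x) (h • y)) (stdGaussian E) := by
      simp only [inner_smul_right]
      exact (int_inner _).const_mul h
    have e0 : ∫ y, inner ℝ (v i x) (h • y) ∂(stdGaussian E) = 0 := by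
      simp only [inner_smul_right]
      rw [integral_const_mul, mean_inner, mul_zero]
    have i12 : Integrable (fun y => F i (x + h • y) - F i x) (stdGaussian E) :=
      i1.sub (integrable_const _)
    have e1 : A i - F i x
        = ∫ y, (F i (x + h • y) - F i x - inner ℝ (v i x) (h • y)) ∂(stdGaussian E) := by
      rw [integral_sub i12 i2, integral_sub i1 (integrable_const _), e0]
      simp [hA]
    rw [e1, hm2, ← integral_const_mul, ← Real.norm_eq_abs]
    refine norm_integral_le_of_norm_le ((int_pow (E := E) 2).const_mul _)
      (Filter.Eventually.of_forall fun y => ?_)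
    have := (hF i).tay x (h • y)
    rw [norm_smul, mul_pow, Real.norm_eq_abs, sq_abs] at this
    rw [Real.norm_eq_abs]
    linarith
  have hpoint : ∀ y, ∏ i, (1 + d i y) ^ c i ≤ 1 + ∑ i, c i * d i y
      + h ^ 2 * ((∑ i, c i * inner ℝ (w i) y) ^ 2 - ∑ i, c i * (inner ℝ (w i) y) ^ 2) / 2
      + C1 * h ^ 3 * Z y ^ 3 := by
    intro y
    have hFA : ∀ i, 0 < F i (x + h • y) / A i := fun i =>
      div_pos (ha.trans_le ((hF i).lb _)) (hA0 i)
    refine H h (Z y) (fun i => d i y) (fun i => inner ℝ (w i) y)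
      (fun i => d i y - h * inner ℝ (w i) y) h0 h1 (hZ1 y) ?_ ?_ ?_ ?_ ?_
    · intro i
      have := hFA i
      simp only [hd]; linarith
    · intro i
      have h1 := hFA i
      have h2 : F i (x + h • y) / A i ≤ M / a :=
        div_le_div₀ (ha.le.trans hM) ((hF i).ub _) ha (hAa i)
      simp only [hd]
      rw [abs_le]; constructor <;> linarith
    · intro i; ring
    · intro i
      refine (abs_real_inner_le_norm _ _).trans ?_
      have e1 : ‖w i‖ ≤ L / a := by
        simp only [hw]
        rw [norm_smul, norm_inv, Real.norm_eq_abs, abs_of_pos (hA0 i), inv_mul_eq_div]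
        exact div_le_div₀ hL ((hF i).vb x) ha (hAa i)
      have e2 : ‖y‖ ≤ Z y := by simp only [hZ]; nlinarith [sq_nonneg (‖y‖ - 1)]
      exact mul_le_mul e1 e2 (norm_nonneg _) (by positivity)
    · intro i
      have e1 : d i y - h * inner ℝ (w i) y
          = ((F i (x + h • y) - F i x - inner ℝ (v i x) (h • y)) - (A i - F i x)) / A i := by
        simp only [hd, hw, inner_smul_left, inner_smul_right, RCLike.conj_to_real]
        have := (hA0 i).ne'
        field_simp
        ring
      rw [e1, abs_div, abs_of_pos (hA0 i)]
      have e2 := (hF i).tay x (h • y)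
      rw [norm_smul, mul_pow, Real.norm_eq_abs, sq_abs] at e2
      have e3 := hmean i
      have e4 : |(F i (x + h • y) - F i x - inner ℝ (v i x) (h • y)) - (A i - F i x)|
          ≤ L * h ^ 2 * Z y := by
        refine (abs_sub _ _).trans ?_
        have : 0 ≤ L * h ^ 2 := by positivity
        simp only [hZ]
        nlinarith
      have e5 : L / a * h ^ 2 * Z y = (L * h ^ 2 * Z y) / a := by ring
      rw [e5]
      have := hZ1 y
      exact div_le_div₀ (by positivity) e4 ha (hAa i)
  have hwW : ∀ i, w i ∈ W i := fun i => (W i).smul_mem _ ((hF i).vW x)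
  have hsum_inner : ∀ y, ∑ i, c i * inner ℝ (w i) y = inner ℝ (∑ i, c i • w i) y := by
    intro y
    rw [sum_inner]
    exact Finset.sum_congr rfl fun i _ => (real_inner_smul_left (w i) y (c i)).symm
  have J1 : Integrable (fun y => ∑ i, c i * d i y) (stdGaussian E) :=
    integrable_finsetSum _ fun i _ => (hdint i).const_mul _
  have J2 : Integrable (fun y => (∑ i, c i * inner ℝ (w i) y) ^ 2) (stdGaussian E) := by
    simp only [hsum_inner]; exact int_inner_sq _
  have J3 : Integrable (fun y => ∑ i, c i * (inner ℝ (w i) y) ^ 2) (stdGaussian E) :=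
    integrable_finsetSum _ fun i _ => (int_inner_sq _).const_mul _
  have I1 : ∫ y, ∑ i, c i * d i y ∂(stdGaussian E) = 0 := by
    rw [integral_finsetSum _ fun i _ => (hdint i).const_mul _]
    simp [integral_const_mul, hdmean]
  have I2 : ∫ y, (∑ i, c i * inner ℝ (w i) y) ^ 2 ∂(stdGaussian E) = ‖∑ i, c i • w i‖ ^ 2 := by
    simp only [hsum_inner]; exact var_inner _
  have I3 : ∫ y, ∑ i, c i * (inner ℝ (w i) y) ^ 2 ∂(stdGaussian E) = ∑ i, c i * ‖w i‖ ^ 2 := by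
    rw [integral_finsetSum _ fun i _ => (int_inner_sq _).const_mul _]
    simp only [integral_const_mul, var_inner]
  have J23 : Integrable (fun y => h ^ 2 * ((∑ i, c i * inner ℝ (w i) y) ^ 2
      - ∑ i, c i * (inner ℝ (w i) y) ^ 2) / 2) (stdGaussian E) :=
    ((J2.sub J3).const_mul _).div_const _
  have J01 : Integrable (fun y => 1 + ∑ i, c i * d i y) (stdGaussian E) :=
    (integrable_const _).add J1
  have J4 : Integrable (fun y => C1 * h ^ 3 * Z y ^ 3) (stdGaussian E) := hZint.const_mul _
  have J0123 : Integrable (fun y => 1 + ∑ i, c i * d i y + h ^ 2 * ((∑ i, c i * inner ℝ (w i) y) ^ 2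
      - ∑ i, c i * (inner ℝ (w i) y) ^ 2) / 2) (stdGaussian E) := J01.add J23
  have hIntg : ∫ y, ∏ i, (1 + d i y) ^ c i ∂(stdGaussian E)
      ≤ 1 + (C1 * ∫ y, Z y ^ 3 ∂(stdGaussian E)) * h ^ 3 := by
    have hm := integral_mono_of_nonneg (μ := stdGaussian E)
      (f := fun y => ∏ i, (1 + d i y) ^ c i)
      (Filter.Eventually.of_forall fun y => Finset.prod_nonneg fun i _ => Real.rpow_nonneg (by
        simp only [hd]
        have : 0 < F i (x + h • y) / A i := div_pos (ha.trans_le ((hF i).lb _)) (hA0 i)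
        linarith) _) (J0123.add J4) (Filter.Eventually.of_forall hpoint)
    refine hm.trans ?_
    have e : ∫ y, (1 + ∑ i, c i * d i y + h ^ 2 * ((∑ i, c i * inner ℝ (w i) y) ^ 2
      - ∑ i, c i * (inner ℝ (w i) y) ^ 2) / 2 + C1 * h ^ 3 * Z y ^ 3) ∂(stdGaussian E)
      = 1 + h ^ 2 * (‖∑ i, c i • w i‖ ^ 2 - ∑ i, c i * ‖w i‖ ^ 2) / 2
        + C1 * h ^ 3 * ∫ y, Z y ^ 3 ∂(stdGaussian E) := by
      rw [integral_add J0123 J4, integral_add J01 J23, integral_add (integrable_const _) J1, I1,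
        integral_div, integral_const_mul, integral_sub J2 J3, I2, I3, integral_const_mul]
      simp
    refine e.le.trans ?_
    have := mul_nonneg (sq_nonneg h) (sub_nonneg.2 (hW w hwW))
    nlinarith
  have hfac : ∀ y, ∏ i, F i (x + h • y) ^ c i = (∏ i, (1 + d i y) ^ c i) * ∏ i, A i ^ c i := by
    intro y
    rw [← Finset.prod_mul_distrib]
    refine Finset.prod_congr rfl fun i _ => ?_
    have : F i (x + h • y) = (1 + d i y) * A i := by
      simp only [hd]; have := (hA0 i).ne'; field_simp; ring
    rw [this, Real.mul_rpow _ (hA0 i).le]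
    simp only [hd]
    have : 0 < F i (x + h • y) / A i := div_pos (ha.trans_le ((hF i).lb _)) (hA0 i)
    linarith
  simp only [hfac]
  rw [integral_mul_const]
  exact mul_le_mul_of_nonneg_right hIntg (Finset.prod_nonneg fun i _ =>
    Real.rpow_nonneg (hA0 i).le _)

theorem nice_ineq {W : ι → Submodule ℝ E} {a M L : ℝ} (ha : 0 < a) (hM : a ≤ M) (hL : 0 ≤ L)
    {c : ι → ℝ} (hc0 : ∀ i, 0 ≤ c i) (hc1 : ∀ i, c i ≤ 1)
    (hW : ∀ w : ι → E, (∀ i, w i ∈ W i) → ‖∑ i, c i • w i‖ ^ 2 ≤ ∑ i, c i * ‖w i‖ ^ 2)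
    (F : ι → E → ℝ) (v : ι → E → E) (hF : ∀ i, Nice (W i) a M L (F i) (v i)) :
    ∫ y, ∏ i, F i y ^ c i ∂(stdGaussian E) ≤ ∏ i, (∫ y, F i y ∂(stdGaussian E)) ^ c i := by
  obtain ⟨C, hC, H⟩ := one_step ha hM hL hc0 hc1 hW
  have := Hyp.limit ha hc0 hC H F v hF 0
  simpa using this

end BL
namespace BL
open ProbabilityTheory

set_option linter.unusedSectionVars false

variable {E : Type*} [NormedAddCommGroup E] [InnerProductSpace ℝ E] [FiniteDimensional ℝ E]
  [MeasurableSpace E] [BorelSpace E]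

lemma smooth_bounds {G : Type*} [NormedAddCommGroup G] [InnerProductSpace ℝ G]
    [FiniteDimensional ℝ G] {u : G → ℝ} (hu : ContDiff ℝ 2 u) (hc : HasCompactSupport u) :
    ∃ K : ℝ, 0 ≤ K ∧ (∀ z, |u z| ≤ K) ∧ (∀ z, ‖fderiv ℝ u z‖ ≤ K) ∧
      ∀ z k, |u (z + k) - u z - fderiv ℝ u z k| ≤ K * ‖k‖ ^ 2 := by
  obtain ⟨C0, h0⟩ := hc.exists_bound_of_continuous hu.continuous
  have hu' : ContDiff ℝ 1 (fderiv ℝ u) := hu.fderiv_right (by norm_num)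
  have hc' : HasCompactSupport (fderiv ℝ u) := hc.fderiv ℝ
  obtain ⟨C1, h1⟩ := hc'.exists_bound_of_continuous hu'.continuous
  obtain ⟨C2, h2⟩ := ContDiff.lipschitzWith_of_hasCompactSupport hc' hu' one_ne_zero
  have hC0 : 0 ≤ C0 := (norm_nonneg _).trans (h0 0)
  have hC1 : 0 ≤ C1 := (norm_nonneg _).trans (h1 0)
  have hC2 : (0:ℝ) ≤ C2 := C2.2
  refine ⟨C0 + C1 + C2, by positivity, fun z => ?_, fun z => ?_, fun z k => ?_⟩
  · have := h0 z
    rw [Real.norm_eq_abs] at this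
    linarith
  · have := h1 z
    linarith
  · have := Convex.norm_image_sub_le_of_norm_fderiv_le' (𝕜 := ℝ) (f := u) (φ := fderiv ℝ u z)
      (s := Metric.closedBall z ‖k‖) (C := C2 * ‖k‖) (x := z) (y := z + k)
      (fun x _ => (hu.differentiable (by norm_num)) x) (fun x hx => by
        have e1 := h2.dist_le_mul x z
        rw [dist_eq_norm] at e1
        refine e1.trans ?_
        have : dist x z ≤ ‖k‖ := hx
        gcongr) (convex_closedBall _ _) (by simp) (by simp)
    rw [add_sub_cancel_left, Real.norm_eq_abs] at this
    refine this.trans ?_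
    have : 0 ≤ (C0 + C1) * ‖k‖ ^ 2 := by positivity
    nlinarith

lemma nice_of_smooth {G : Type*} [NormedAddCommGroup G] [InnerProductSpace ℝ G]
    [FiniteDimensional ℝ G] [MeasurableSpace G] [BorelSpace G] (T : E →L[ℝ] G)
    {ψ : G → ℝ} (hψ : ContDiff ℝ 2 ψ) (hc : HasCompactSupport ψ) {ε : ℝ} (hε : 0 < ε) :
    ∃ K : ℝ, 0 ≤ K ∧ ∃ v : E → E, ∀ M, K ≤ M →
      Nice (LinearMap.range (ContinuousLinearMap.adjoint T).toLinearMap) ε (ε + M) M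
        (fun x => ψ (T x) ^ 2 + ε) v := by
  set u : G → ℝ := fun z => ψ z ^ 2 with hu
  have hu2 : ContDiff ℝ 2 u := hψ.pow 2
  have huc : HasCompactSupport u := by
    have : u = fun z => ψ z * ψ z := by funext z; simp [hu, sq]
    rw [this]; exact hc.mul_left
  obtain ⟨K, hK, k0, k1, k2⟩ := smooth_bounds hu2 huc
  have hT := norm_nonneg T
  refine ⟨K + ‖T‖ * K + K * ‖T‖ ^ 2, by positivity,
    fun x => ContinuousLinearMap.adjoint T ((InnerProductSpace.toDual ℝ G).symm
      (fderiv ℝ u (T x))), fun M hM => ?_⟩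
  have q1 : 0 ≤ ‖T‖ * K := by positivity
  have q2 : 0 ≤ K * ‖T‖ ^ 2 := by positivity
  refine ⟨?_, ?_, ?_, ?_, ?_, ?_, ?_⟩
  · exact (((hψ.continuous.comp T.continuous).pow 2).add continuous_const).measurable
  · have : Continuous (fderiv ℝ u) := hu2.continuous_fderiv (by norm_num)
    exact ((ContinuousLinearMap.adjoint T).continuous.comp
      ((InnerProductSpace.toDual ℝ G).symm.continuous.comp (this.comp T.continuous))).measurable
  · intro x
    nlinarith [sq_nonneg (ψ (T x))]
  · intro x
    have := (abs_le.1 (k0 (T x))).2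
    simp only [hu] at this
    show ψ (T x) ^ 2 + ε ≤ _
    linarith
  · intro x
    refine (ContinuousLinearMap.le_opNorm _ _).trans ?_
    rw [LinearIsometryEquiv.norm_map, LinearIsometryEquiv.norm_map]
    have := mul_le_mul_of_nonneg_left (k1 (T x)) hT
    linarith
  · intro x
    exact ⟨_, rfl⟩
  · intro x y
    rw [ContinuousLinearMap.adjoint_inner_left, InnerProductSpace.toDual_symm_apply]
    have := k2 (T x) (T y)
    rw [← map_add] at this
    have e : ψ (T (x + y)) ^ 2 + ε - (ψ (T x) ^ 2 + ε) - fderiv ℝ u (T x) (T y)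
      = u (T (x + y)) - u (T x) - fderiv ℝ u (T x) (T y) := by simp only [hu]; ring
    rw [e]
    refine this.trans ?_
    have h3 : ‖T y‖ ^ 2 ≤ (‖T‖ * ‖y‖) ^ 2 := by
      gcongr; exact T.le_opNorm y
    calc K * ‖T y‖ ^ 2 ≤ K * (‖T‖ * ‖y‖) ^ 2 := by gcongr
      _ = (K * ‖T‖ ^ 2) * ‖y‖ ^ 2 := by ring
      _ ≤ M * ‖y‖ ^ 2 := by gcongr; linarith

lemma approx {G : Type*} [NormedAddCommGroup G] [InnerProductSpace ℝ G]
    [FiniteDimensional ℝ G] [MeasurableSpace G] [BorelSpace G] (ν : Measure G) [IsFiniteMeasure ν]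
    {φ : G → ℝ} (hφ : MemLp φ 2 ν) :
    ∃ ψ : ℕ → G → ℝ, (∀ j, ContDiff ℝ 2 (ψ j)) ∧ (∀ j, HasCompactSupport (ψ j)) ∧
      (∀ᵐ z ∂ν, Filter.Tendsto (fun j => ψ j z) Filter.atTop (nhds (φ z))) ∧
      ∀ j : ℕ, eLpNorm (ψ j) 2 ν ≤ eLpNorm φ 2 ν + ENNReal.ofReal (1 / ((j : ℝ) + 1)) := by
  have H : ∀ j : ℕ, ∃ g : G → ℝ, HasCompactSupport g ∧ ContDiff ℝ ((⊤ : ℕ∞) : WithTop ℕ∞) g ∧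
      eLpNorm (φ - g) 2 ν ≤ ENNReal.ofReal (1 / ((j : ℝ) + 1)) := fun j =>
    hφ.exist_eLpNorm_sub_le (by norm_num) (by norm_num) (by positivity)
  choose g gc gs ge using H
  have hlim : Filter.Tendsto (fun j : ℕ => ENNReal.ofReal (1 / ((j : ℝ) + 1))) Filter.atTop
      (nhds 0) := by
    have := ENNReal.tendsto_ofReal (tendsto_one_div_add_atTop_nhds_zero_nat (𝕜 := ℝ))
    simpa using this
  have hm : TendstoInMeasure ν g Filter.atTop φ := by
    refine tendstoInMeasure_of_tendsto_eLpNorm (p := 2) (by norm_num)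
      (fun j => (gs j).continuous.aestronglyMeasurable) hφ.1 ?_
    refine tendsto_of_tendsto_of_tendsto_of_le_of_le tendsto_const_nhds hlim
      (fun _ => zero_le) (fun j => ?_)
    show eLpNorm (g j - φ) 2 ν ≤ _
    rw [eLpNorm_sub_comm]
    exact ge j
  obtain ⟨ns, hns, hae⟩ := hm.exists_seq_tendsto_ae
  refine ⟨fun j => g (ns j), fun j => contDiff_infty.1 (gs _) 2, fun j => gc _, hae,
    fun j => ?_⟩
  have e1 : g (ns j) = φ - (φ - g (ns j)) := by simp
  calc eLpNorm (g (ns j)) 2 ν = eLpNorm (φ - (φ - g (ns j))) 2 ν := by rw [← e1]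
    _ ≤ eLpNorm φ 2 ν + eLpNorm (φ - g (ns j)) 2 ν :=
      eLpNorm_sub_le hφ.1 (hφ.1.sub (gs _).continuous.aestronglyMeasurable) (by norm_num)
    _ ≤ _ := by
      gcongr
      refine (ge (ns j)).trans (ENNReal.ofReal_le_ofReal ?_)
      have : (j : ℝ) ≤ ns j := by exact_mod_cast hns.id_le j
      gcongr

lemma tendsto_prod_ennreal {ι : Type*} (s : Finset ι) {f : ι → ℕ → ℝ≥0∞} {b : ι → ℝ≥0∞}
    (hb : ∀ i, b i ≠ ⊤) (h : ∀ i, Filter.Tendsto (f i) Filter.atTop (nhds (b i))) :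
    Filter.Tendsto (fun j => ∏ i ∈ s, f i j) Filter.atTop (nhds (∏ i ∈ s, b i)) := by
  classical
  induction s using Finset.induction_on with
  | empty => simpa using tendsto_const_nhds
  | insert i s hi ih =>
    simp only [Finset.prod_insert hi]
    exact ENNReal.Tendsto.mul (h i) (Or.inr (ENNReal.prod_ne_top fun k _ => hb k)) ih
      (Or.inr (hb i))

lemma eLpNorm_sq {G : Type*} [MeasurableSpace G] (ν : Measure G) (ψ : G → ℝ) :
    ∫⁻ z, ENNReal.ofReal (ψ z ^ 2) ∂ν = eLpNorm ψ 2 ν ^ 2 := by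
  rw [eLpNorm_eq_lintegral_rpow_enorm_toReal (by norm_num) (by norm_num), ← ENNReal.rpow_natCast,
    ← ENNReal.rpow_mul]
  simp only [ENNReal.toReal_ofNat, Nat.cast_ofNat]
  norm_num
  refine lintegral_congr fun z => ?_
  rw [← sq_abs, ENNReal.ofReal_pow (abs_nonneg _), Real.enorm_eq_ofReal_abs]

variable {ι : Type*} [Fintype ι] {G : ι → Type*} [∀ i, NormedAddCommGroup (G i)]
  [∀ i, InnerProductSpace ℝ (G i)] [∀ i, FiniteDimensional ℝ (G i)]
  [∀ i, MeasurableSpace (G i)] [∀ i, BorelSpace (G i)]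

theorem gauss_ineq (T : ∀ i, E →L[ℝ] G i)
    {c : ι → ℝ} (hc0 : ∀ i, 0 ≤ c i) (hc1 : ∀ i, c i ≤ 1)
    (hT : ∀ u : ∀ i, G i, ‖∑ i, c i • ContinuousLinearMap.adjoint (T i) (u i)‖ ^ 2
      ≤ ∑ i, c i * ‖ContinuousLinearMap.adjoint (T i) (u i)‖ ^ 2)
    (g : ∀ i, G i → ℝ) (gm : ∀ i, Measurable (g i)) (g0 : ∀ i z, 0 ≤ g i z)
    (gfin : ∀ i, ∫⁻ x, ENNReal.ofReal (g i (T i x)) ∂(stdGaussian E) ≠ ⊤) :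
    ∫⁻ x, ∏ i, ENNReal.ofReal (g i (T i x)) ^ c i ∂(stdGaussian E)
      ≤ ∏ i, (∫⁻ x, ENNReal.ofReal (g i (T i x)) ∂(stdGaussian E)) ^ c i := by
  have hTm : ∀ i, Measurable (T i) := fun i => (T i).continuous.measurable
  set ν : ∀ i, Measure (G i) := fun i => (stdGaussian E).map (T i) with hν
  have hνp : ∀ i, IsProbabilityMeasure (ν i) := fun i =>
    Measure.isProbabilityMeasure_map (hTm i).aemeasurable
  set φ : ∀ i, G i → ℝ := fun i z => Real.sqrt (g i z) with hφ
  have hφm : ∀ i, Measurable (φ i) := fun i => (gm i).sqrt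
  have hφ2 : ∀ i z, φ i z ^ 2 = g i z := fun i z => Real.sq_sqrt (g0 i z)
  have hN : ∀ i, ∫⁻ x, ENNReal.ofReal (g i (T i x)) ∂(stdGaussian E) = eLpNorm (φ i) 2 (ν i) ^ 2 := by
    intro i
    rw [← eLpNorm_sq, hν, lintegral_map (by have := hφm i; fun_prop) (hTm i)]
    simp only [hφ2]
  have hNfin : ∀ i, eLpNorm (φ i) 2 (ν i) ≠ ⊤ := by
    intro i h
    apply gfin i
    rw [hN i, h]; simp
  have hmem : ∀ i, MemLp (φ i) 2 (ν i) := fun i =>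
    ⟨(hφm i).aestronglyMeasurable, (hNfin i).lt_top⟩
  choose ψ ψs ψc ψae ψn using fun i => approx (ν i) (hmem i)
  set e : ℕ → ℝ := fun j => 1 / ((j : ℝ) + 1) with he
  have he0 : ∀ j, 0 < e j := fun j => by simp only [he]; positivity
  have helim : Filter.Tendsto e Filter.atTop (nhds 0) := tendsto_one_div_add_atTop_nhds_zero_nat
  have helim' : Filter.Tendsto (fun j => ENNReal.ofReal (e j)) Filter.atTop (nhds 0) := by
    simpa using ENNReal.tendsto_ofReal helim
  set F : ℕ → ι → E → ℝ := fun j i x => ψ i j (T i x) ^ 2 + e j with hF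
  have hF0 : ∀ j i x, 0 ≤ F j i x := fun j i x => by
    have := he0 j
    simp only [hF]; positivity
  have hFm : ∀ j i, Measurable (F j i) := fun j i =>
    ((((ψs i j).continuous.comp (T i).continuous).pow 2).add continuous_const).measurable
  have stepj : ∀ j, ∫⁻ x, ∏ i, ENNReal.ofReal (F j i x) ^ c i ∂(stdGaussian E)
      ≤ ∏ i, (∫⁻ x, ENNReal.ofReal (F j i x) ∂(stdGaussian E)) ^ c i := by
    intro j
    choose K hK v hv using fun i => nice_of_smooth (T i) (ψs i j) (ψc i j) (he0 j)
    set M := ∑ i, K i with hM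
    have hM0 : 0 ≤ M := Finset.sum_nonneg fun i _ => hK i
    have hnice := fun i => hv i M (Finset.single_le_sum (fun i _ => hK i) (Finset.mem_univ i))
    have hmain := nice_ineq (he0 j) (show e j ≤ e j + M by linarith) hM0 hc0 hc1 (fun w hw => by
      choose u hu using hw
      have := hT u
      simp only [ContinuousLinearMap.coe_coe] at hu
      simpa only [hu] using this) (F j) v hnice
    have hIntg : ∀ i, Integrable (F j i) (stdGaussian E) := fun i => by
      exact bdd_int (hnice i).measF ((hnice i).abs_le (he0 j))
    have e1 : ∀ x, ∏ i, ENNReal.ofReal (F j i x) ^ c i = ENNReal.ofReal (∏ i, F j i x ^ c i) := by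
      intro x
      rw [ENNReal.ofReal_prod_of_nonneg fun i _ => Real.rpow_nonneg (hF0 j i x) _]
      exact Finset.prod_congr rfl fun i _ => ENNReal.ofReal_rpow_of_nonneg (hF0 j i x) (hc0 i)
    have e2 : ∀ i, (∫⁻ x, ENNReal.ofReal (F j i x) ∂(stdGaussian E))
        = ENNReal.ofReal (∫ x, F j i x ∂(stdGaussian E)) := fun i =>
      (ofReal_integral_eq_lintegral_ofReal (hIntg i)
        (Filter.Eventually.of_forall (hF0 j i))).symm
    simp only [e1, e2]
    have hpi : Integrable (fun x => ∏ i, F j i x ^ c i) (stdGaussian E) :=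
      bdd_int (prod_meas hnice) (prod_bdd (he0 j) hc0 hnice)
    rw [← ofReal_integral_eq_lintegral_ofReal hpi (Filter.Eventually.of_forall fun x =>
      Finset.prod_nonneg fun i _ => Real.rpow_nonneg (hF0 j i x) _)]
    refine (ENNReal.ofReal_le_ofReal hmain).trans_eq ?_
    rw [ENNReal.ofReal_prod_of_nonneg fun i _ => Real.rpow_nonneg (integral_nonneg (hF0 j i)) _]
    exact Finset.prod_congr rfl fun i _ =>
      (ENNReal.ofReal_rpow_of_nonneg (integral_nonneg (hF0 j i)) (hc0 i)).symm
  have bound : ∀ j i, ∫⁻ x, ENNReal.ofReal (F j i x) ∂(stdGaussian E)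
      ≤ (eLpNorm (φ i) 2 (ν i) + ENNReal.ofReal (e j)) ^ 2 + ENNReal.ofReal (e j) := by
    intro j i
    have e1 : ∀ x, ENNReal.ofReal (F j i x) = ENNReal.ofReal (ψ i j (T i x) ^ 2)
        + ENNReal.ofReal (e j) := fun x => ENNReal.ofReal_add (sq_nonneg _) (he0 j).le
    simp only [e1]
    rw [lintegral_add_right _ measurable_const]
    have e2 : ∫⁻ x, ENNReal.ofReal (ψ i j (T i x) ^ 2) ∂(stdGaussian E)
        = eLpNorm (ψ i j) 2 (ν i) ^ 2 := by
      rw [← eLpNorm_sq, hν, lintegral_map (by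
        have := (ψs i j).continuous.measurable
        fun_prop) (hTm i)]
    rw [e2]
    simp only [lintegral_const, measure_univ, mul_one]
    gcongr
    exact ψn i j
  have fatou := lintegral_liminf_le (μ := stdGaussian E) (u := Filter.atTop)
    (f := fun j x => ∏ i, ENNReal.ofReal (F j i x) ^ c i)
    (fun j => Finset.measurable_prod _ fun i _ => ((hFm j i).ennreal_ofReal.pow_const _))
  have lhs : ∫⁻ x, ∏ i, ENNReal.ofReal (g i (T i x)) ^ c i ∂(stdGaussian E)
      = ∫⁻ x, Filter.liminf (fun j => ∏ i, ENNReal.ofReal (F j i x) ^ c i) Filter.atTop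
        ∂(stdGaussian E) := by
    have hae : ∀ᵐ x ∂(stdGaussian E), ∀ i, Filter.Tendsto (fun j => ψ i j (T i x)) Filter.atTop
        (nhds (φ i (T i x))) := by
      rw [ae_all_iff]
      intro i
      exact ae_of_ae_map (hTm i).aemeasurable (ψae i)
    refine lintegral_congr_ae ?_
    filter_upwards [hae] with x hx
    symm
    refine Filter.Tendsto.liminf_eq ?_
    refine tendsto_prod_ennreal _ (fun i => ENNReal.rpow_ne_top_of_nonneg (hc0 i)
      ENNReal.ofReal_ne_top) fun i => ?_
    refine ((ENNReal.continuous_rpow_const).tendsto _).comp (ENNReal.tendsto_ofReal ?_)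
    have := ((hx i).pow 2).add helim
    simpa only [hφ2, add_zero] using this
  rw [lhs]
  refine fatou.trans ?_
  have rhs : Filter.Tendsto (fun j => ∏ i, ((eLpNorm (φ i) 2 (ν i) + ENNReal.ofReal (e j)) ^ 2
      + ENNReal.ofReal (e j)) ^ c i) Filter.atTop
      (nhds (∏ i, (∫⁻ x, ENNReal.ofReal (g i (T i x)) ∂(stdGaussian E)) ^ c i)) := by
    refine tendsto_prod_ennreal _ (fun i => ENNReal.rpow_ne_top_of_nonneg (hc0 i) (gfin i))
      fun i => ?_
    refine ((ENNReal.continuous_rpow_const).tendsto _).comp ?_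
    rw [hN i]
    have h1 : Filter.Tendsto (fun j => eLpNorm (φ i) 2 (ν i) + ENNReal.ofReal (e j)) Filter.atTop
        (nhds (eLpNorm (φ i) 2 (ν i) + 0)) := tendsto_const_nhds.add helim'
    have h2 := ((ENNReal.continuous_pow 2).tendsto _).comp h1
    have h3 := h2.add helim'
    simpa only [add_zero, Function.comp_def] using h3
  rw [← rhs.liminf_eq]
  refine Filter.liminf_le_liminf (Filter.Eventually.of_forall fun j => ?_)
  refine (stepj j).trans ?_
  exact Finset.prod_le_prod' fun i _ => ENNReal.rpow_le_rpow (bound j i) (hc0 i)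

end BL
namespace BL
open ProbabilityTheory

lemma lin_cov {k : ℕ} {M : Matrix (Fin k) (Fin k) ℝ} (hM : M.det ≠ 0)
    {h : (Fin k → ℝ) → ℝ≥0∞} (hm : Measurable h) :
    ∫⁻ x, h x = ENNReal.ofReal |M.det| * ∫⁻ y, h (M *ᵥ y) := by
  have h1 := Real.map_matrix_volume_pi_eq_smul_volume_pi hM
  have hmM : Measurable (Matrix.toLin' M) := (LinearMap.continuous_of_finiteDimensional _).measurable
  have h2 : ∫⁻ y, h (M *ᵥ y) = ∫⁻ x, h x ∂(Measure.map (toLin' M) volume) := by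
    rw [lintegral_map hm hmM]
    rfl
  rw [h2, h1, lintegral_smul_measure, smul_eq_mul, ← mul_assoc, ← ENNReal.ofReal_mul (abs_nonneg _),
    ← abs_mul, mul_inv_cancel₀ hM]
  simp

lemma pi_gaussian_density (k : ℕ) :
    Measure.pi (fun _ : Fin k => gaussianReal 0 1)
      = (volume : Measure (Fin k → ℝ)).withDensity
        (fun x => ENNReal.ofReal (∏ i, gaussianPDFReal 0 1 (x i))) := by
  refine Measure.pi_eq fun s hs => ?_
  rw [withDensity_apply _ (MeasurableSet.univ_pi hs), volume_pi, Measure.restrict_pi_pi]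
  have hIntg : ∀ i, Integrable (gaussianPDFReal 0 1) (volume.restrict (s i)) := fun i =>
    (integrable_gaussianPDFReal 0 1).restrict
  rw [← ofReal_integral_eq_lintegral_ofReal (Integrable.fintype_prod hIntg)
    (Filter.Eventually.of_forall fun x => Finset.prod_nonneg fun i _ =>
      gaussianPDFReal_nonneg _ _ _),
    integral_fintype_prod_eq_prod (𝕜 := ℝ) (fun _ : Fin k => gaussianPDFReal 0 1),
    ENNReal.ofReal_prod_of_nonneg fun i _ => integral_nonneg fun x => gaussianPDFReal_nonneg _ _ _]
  refine Finset.prod_congr rfl fun i _ => ?_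
  rw [gaussianReal_apply_eq_integral _ (by norm_num)]

lemma prod_pdf {k : ℕ} (x : Fin k → ℝ) : ∏ i, gaussianPDFReal 0 1 (x i)
    = (2 * Real.pi) ^ (-(k : ℝ) / 2) * Real.exp (-(x ⬝ᵥ x) / 2) := by
  simp only [gaussianPDFReal, Finset.prod_mul_distrib, ← Real.exp_sum]
  congr 1
  · simp only [NNReal.coe_one, mul_one, Finset.prod_const, Finset.card_univ, Fintype.card_fin]
    rw [Real.sqrt_eq_rpow, ← Real.rpow_neg (by positivity), ← Real.rpow_natCast,
      ← Real.rpow_mul (by positivity)]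
    congr 1; ring
  · congr 1
    simp only [dotProduct, NNReal.coe_one, sub_zero, mul_one]
    rw [neg_div, Finset.sum_div, ← Finset.sum_neg_distrib]
    exact Finset.sum_congr rfl fun i _ => by ring

lemma std_density {k : ℕ} {h : (Fin k → ℝ) → ℝ≥0∞} (hm : Measurable h) :
    ∫⁻ y, h y.ofLp ∂(stdGaussian (EuclideanSpace ℝ (Fin k)))
      = ENNReal.ofReal ((2 * Real.pi) ^ (-(k : ℝ) / 2)) *
        ∫⁻ y, h y * ENNReal.ofReal (Real.exp (-(y ⬝ᵥ y) / 2)) := by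
  have hc : Measurable fun x : Fin k → ℝ => Real.exp (-(x ⬝ᵥ x) / 2) := by
    unfold dotProduct; fun_prop
  rw [← map_pi_eq_stdGaussian, lintegral_map (by fun_prop) (by fun_prop), pi_gaussian_density]
  simp only [prod_pdf]
  rw [lintegral_withDensity_eq_lintegral_mul _ (by fun_prop) (by fun_prop),
    ← lintegral_const_mul _ (by fun_prop)]
  refine lintegral_congr fun y => ?_
  simp only [Pi.mul_apply]
  rw [ENNReal.ofReal_mul (by positivity)]
  ring

/-- matrix as a continuous linear map of Euclidean spaces -/
noncomputable def mL {k n : ℕ} (T : Matrix (Fin k) (Fin n) ℝ) :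
    EuclideanSpace ℝ (Fin n) →L[ℝ] EuclideanSpace ℝ (Fin k) :=
  LinearMap.toContinuousLinearMap (Matrix.toLpLin 2 2 T)

lemma mL_apply {k n : ℕ} (T : Matrix (Fin k) (Fin n) ℝ) (y : EuclideanSpace ℝ (Fin n)) :
    (mL T y).ofLp = T *ᵥ y.ofLp := by
  simp [mL]

lemma mL_adj {k n : ℕ} (T : Matrix (Fin k) (Fin n) ℝ) :
    ContinuousLinearMap.adjoint (mL T) = mL Tᵀ := by
  symm
  rw [ContinuousLinearMap.eq_adjoint_iff]
  intro x y
  simp only [EuclideanSpace.inner_eq_star_dotProduct, mL_apply, star_trivial]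
  rw [Matrix.mulVec_transpose, dotProduct_comm, ← Matrix.dotProduct_mulVec, dotProduct_comm]

lemma normsq {k : ℕ} (x : EuclideanSpace ℝ (Fin k)) : ‖x‖ ^ 2 = x.ofLp ⬝ᵥ x.ofLp := by
  rw [EuclideanSpace.real_norm_sq_eq]
  simp [dotProduct, sq]

lemma same_law {k n l : ℕ} (T : Matrix (Fin k) (Fin n) ℝ) (R : Matrix (Fin k) (Fin l) ℝ)
    (h : T * Tᵀ = R * Rᵀ) :
    (stdGaussian (EuclideanSpace ℝ (Fin n))).map (mL T)
      = (stdGaussian (EuclideanSpace ℝ (Fin l))).map (mL R) := by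
  have : IsProbabilityMeasure ((stdGaussian (EuclideanSpace ℝ (Fin n))).map (mL T)) :=
    Measure.isProbabilityMeasure_map (mL T).continuous.measurable.aemeasurable
  have : IsProbabilityMeasure ((stdGaussian (EuclideanSpace ℝ (Fin l))).map (mL R)) :=
    Measure.isProbabilityMeasure_map (mL R).continuous.measurable.aemeasurable
  have key : ∀ {j : ℕ} (Q : Matrix (Fin k) (Fin j) ℝ) (t : EuclideanSpace ℝ (Fin k)),
      ‖ContinuousLinearMap.adjoint (mL Q) t‖ ^ 2 = t.ofLp ⬝ᵥ ((Q * Qᵀ) *ᵥ t.ofLp) := by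
    intro j Q t
    rw [mL_adj, normsq, mL_apply, ← Matrix.mulVec_mulVec, Matrix.dotProduct_mulVec _ Q,
      Matrix.mulVec_transpose]
  have cf : ∀ {j : ℕ} (Q : Matrix (Fin k) (Fin j) ℝ) (t : EuclideanSpace ℝ (Fin k)),
      charFun ((stdGaussian (EuclideanSpace ℝ (Fin j))).map (mL Q)) t
        = charFun (stdGaussian (EuclideanSpace ℝ (Fin j)))
          (ContinuousLinearMap.adjoint (mL Q) t) := by
    intro j Q t
    rw [charFun_apply, charFun_apply, integral_map (mL Q).continuous.measurable.aemeasurable]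
    · simp only [ContinuousLinearMap.adjoint_inner_right]
    · exact Continuous.aestronglyMeasurable (by fun_prop)
  apply Measure.ext_of_charFun
  ext t
  rw [cf, cf, charFun_stdGaussian, charFun_stdGaussian]
  have : ‖ContinuousLinearMap.adjoint (mL T) t‖ ^ 2 = ‖ContinuousLinearMap.adjoint (mL R) t‖ ^ 2 := by
    rw [key, key, h]
  simp only [← Complex.ofReal_pow, this]

lemma exists_factor {k : ℕ} {A : Matrix (Fin k) (Fin k) ℝ} (hA : A.PosDef) :
    ∃ R : Matrix (Fin k) (Fin k) ℝ, A = R * Rᵀ ∧ R.det ≠ 0 ∧ |R.det| = Real.sqrt A.det := by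
  have h0 := hA.posSemidef
  obtain ⟨R, hR⟩ : ∃ R : Matrix (Fin k) (Fin k) ℝ, A = R * Rᵀ := by
    open scoped MatrixOrder in
    obtain ⟨R, hR⟩ := CStarAlgebra.nonneg_iff_eq_star_mul_self.1 (Matrix.nonneg_iff_posSemidef.2 h0)
    exact ⟨Rᵀ, by rw [hR]; simp [star_eq_conjTranspose, conjTranspose_eq_transpose_of_trivial]⟩
  have hd : A.det = R.det ^ 2 := by rw [hR, det_mul, det_transpose, sq]
  refine ⟨R, hR, fun h => ?_, by rw [hd, Real.sqrt_sq_eq_abs]⟩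
  have := hA.det_pos
  rw [hd, h] at this
  simp at this

lemma factor_dot {k : ℕ} {A R : Matrix (Fin k) (Fin k) ℝ} (hR : A = R * Rᵀ) (hd : R.det ≠ 0)
    (y : Fin k → ℝ) : (A⁻¹ *ᵥ (R *ᵥ y)) ⬝ᵥ (R *ᵥ y) = y ⬝ᵥ y := by
  have hu : IsUnit R.det := isUnit_iff_ne_zero.2 hd
  have hut : IsUnit (Rᵀ).det := by rwa [det_transpose]
  rw [hR, Matrix.mul_inv_rev, Matrix.mulVec_mulVec, Matrix.mul_assoc, Matrix.nonsing_inv_mul _ hu,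
    Matrix.mul_one, Matrix.dotProduct_mulVec, ← Matrix.mulVec_transpose, Matrix.mulVec_mulVec,
    Matrix.mul_nonsing_inv _ hut, Matrix.one_mulVec]

lemma push_density {k n : ℕ} (T : Matrix (Fin k) (Fin n) ℝ) {A : Matrix (Fin k) (Fin k) ℝ}
    (hA : A.PosDef) (hT : T * Tᵀ = A) {h : (Fin k → ℝ) → ℝ≥0∞} (hm : Measurable h) :
    ∫⁻ y, h (T *ᵥ y.ofLp) ∂(stdGaussian (EuclideanSpace ℝ (Fin n)))
      = ENNReal.ofReal ((2 * Real.pi) ^ (-(k : ℝ) / 2) * (Real.sqrt A.det)⁻¹) *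
        ∫⁻ z, h z * ENNReal.ofReal (Real.exp (-((A⁻¹ *ᵥ z) ⬝ᵥ z) / 2)) := by
  obtain ⟨R, hR, hd, hdet⟩ := exists_factor hA
  have hpos : 0 < Real.sqrt A.det := Real.sqrt_pos.2 hA.det_pos
  have e1 : ∫⁻ y, h (T *ᵥ y.ofLp) ∂(stdGaussian (EuclideanSpace ℝ (Fin n)))
      = ∫⁻ y, h (R *ᵥ y.ofLp) ∂(stdGaussian (EuclideanSpace ℝ (Fin k))) := by
    have hm' : Measurable fun z : EuclideanSpace ℝ (Fin k) => h z.ofLp := by fun_prop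
    have a1 := lintegral_map (μ := stdGaussian (EuclideanSpace ℝ (Fin n))) hm'
      (mL T).continuous.measurable
    have a2 := lintegral_map (μ := stdGaussian (EuclideanSpace ℝ (Fin k))) hm'
      (mL R).continuous.measurable
    simp only [mL_apply] at a1 a2
    rw [← a1, ← a2, same_law T R (hT.trans hR)]
  have hmR : Measurable fun y : Fin k → ℝ => R *ᵥ y :=
    (LinearMap.continuous_of_finiteDimensional (Matrix.toLin' R)).measurable
  have hmA : Measurable fun y : Fin k → ℝ => A⁻¹ *ᵥ y :=
    (LinearMap.continuous_of_finiteDimensional (Matrix.toLin' A⁻¹)).measurable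
  rw [e1, std_density (h := fun y => h (R *ᵥ y)) (hm.comp hmR),
    lin_cov hd (h := fun z => h z * ENNReal.ofReal (Real.exp (-((A⁻¹ *ᵥ z) ⬝ᵥ z) / 2)))
      (by unfold dotProduct; fun_prop), hdet, ← mul_assoc, ← ENNReal.ofReal_mul (by positivity),
    mul_assoc, inv_mul_cancel₀ hpos.ne', mul_one]
  simp only [factor_dot hR hd]

lemma gauss_integral {k : ℕ} {A : Matrix (Fin k) (Fin k) ℝ}
    (hA : A.PosDef) : ∫⁻ z, ENNReal.ofReal (Real.exp (-((A⁻¹ *ᵥ z) ⬝ᵥ z)))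
      = ENNReal.ofReal (Real.pi ^ ((k : ℝ) / 2) * Real.sqrt A.det) := by
  obtain ⟨R, hR, hd, hdet⟩ := exists_factor hA
  have hmA : Measurable fun y : Fin k → ℝ => A⁻¹ *ᵥ y :=
    (LinearMap.continuous_of_finiteDimensional (Matrix.toLin' A⁻¹)).measurable
  rw [lin_cov hd (by unfold dotProduct; fun_prop), hdet, mul_comm (Real.pi ^ _),
    ENNReal.ofReal_mul (Real.sqrt_nonneg _)]
  congr 1
  simp only [factor_dot hR hd]
  have h1 := GaussianFourier.integral_rexp_neg_mul_sq_norm (V := EuclideanSpace ℝ (Fin k)) one_pos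
  have h2 : Integrable fun v : EuclideanSpace ℝ (Fin k) => Real.exp (-1 * ‖v‖ ^ 2) := by
    by_contra h
    rw [integral_undef h] at h1
    have : 0 < (Real.pi / 1) ^ ((Module.finrank ℝ (EuclideanSpace ℝ (Fin k)) : ℝ) / 2) := by
      positivity
    linarith
  rw [← (PiLp.volume_preserving_ofLp (Fin k)).lintegral_comp (by unfold dotProduct; fun_prop)]
  simp only [← normsq]
  simp only [neg_mul, one_mul, div_one, finrank_euclideanSpace, Fintype.card_fin] at h1 h2
  rw [← h1, ofReal_integral_eq_lintegral_ofReal h2 (Filter.Eventually.of_forall fun _ => (Real.exp_pos _).le)]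
end BL
namespace BL
open ProbabilityTheory

lemma dot_tr {k l : ℕ} (Q : Matrix (Fin k) (Fin l) ℝ) (x : Fin l → ℝ) (u : Fin k → ℝ) :
    x ⬝ᵥ (Qᵀ *ᵥ u) = u ⬝ᵥ (Q *ᵥ x) := by
  rw [Matrix.mulVec_transpose, dotProduct_comm, ← Matrix.dotProduct_mulVec]

lemma frame_id {n m : ℕ} {nn : Fin m → ℕ} {p : Fin m → ℝ} (hp : ∀ i, 0 < p i)
    (hsum : ∑ i, (nn i : ℝ) / p i = n) (T : ∀ i, Matrix (Fin (nn i)) (Fin n) ℝ)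
    (hA : ∀ i, (T i * (T i)ᵀ).PosDef)
    (hQ : ∀ u : ∀ i, Fin (nn i) → ℝ, (∑ i, (T i)ᵀ *ᵥ u i) ⬝ᵥ (∑ i, (T i)ᵀ *ᵥ u i)
      ≤ ∑ i, p i * (u i ⬝ᵥ ((T i * (T i)ᵀ) *ᵥ u i))) :
    ∑ i, (p i)⁻¹ • ((T i)ᵀ * (T i * (T i)ᵀ)⁻¹ * T i) = 1 := by
  set K : ∀ i, Matrix (Fin n) (Fin n) ℝ := fun i => (T i)ᵀ * (T i * (T i)ᵀ)⁻¹ * T i with hK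
  have hunit : ∀ i, IsUnit (T i * (T i)ᵀ).det := fun i => isUnit_iff_ne_zero.2 (hA i).det_pos.ne'
  have hKh : ∀ i, (K i)ᵀ = K i := by
    intro i
    have : ((T i * (T i)ᵀ)⁻¹)ᵀ = (T i * (T i)ᵀ)⁻¹ := by
      rw [Matrix.transpose_nonsing_inv]; simp
    simp only [hK, transpose_mul, transpose_transpose, this, Matrix.mul_assoc]
  have psd : (1 - ∑ i, (p i)⁻¹ • K i).PosSemidef := by
    rw [posSemidef_iff_dotProduct_mulVec]
    refine ⟨?_, fun x => ?_⟩
    · rw [IsHermitian, conjTranspose_eq_transpose_of_trivial]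
      simp [transpose_sub, transpose_sum, transpose_smul, hKh]
    · set u : ∀ i, Fin (nn i) → ℝ := fun i => (p i)⁻¹ • ((T i * (T i)ᵀ)⁻¹ *ᵥ (T i *ᵥ x)) with hu
      have hw : (∑ i, (p i)⁻¹ • K i) *ᵥ x = ∑ i, (T i)ᵀ *ᵥ u i := by
        rw [Matrix.sum_mulVec]
        refine Finset.sum_congr rfl fun i _ => ?_
        simp only [hK, hu, Matrix.smul_mulVec, Matrix.mulVec_smul, Matrix.mulVec_mulVec,
          Matrix.mul_assoc]
      have h1 := hQ u
      set w := ∑ i, (T i)ᵀ *ᵥ u i with hwd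
      have h2 : ∑ i, p i * (u i ⬝ᵥ ((T i * (T i)ᵀ) *ᵥ u i)) = x ⬝ᵥ w := by
        rw [hwd, dotProduct_sum]
        refine Finset.sum_congr rfl fun i _ => ?_
        rw [dot_tr]
        have : (T i * (T i)ᵀ) *ᵥ u i = (p i)⁻¹ • (T i *ᵥ x) := by
          simp only [hu]
          rw [Matrix.mulVec_smul, Matrix.mulVec_mulVec, Matrix.mul_nonsing_inv _ (hunit i),
            Matrix.one_mulVec]
        rw [this, dotProduct_smul, smul_eq_mul, ← mul_assoc, mul_inv_cancel₀ (hp i).ne', one_mul]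
      rw [h2] at h1
      have h3 : 0 ≤ (x - w) ⬝ᵥ (x - w) := by
        simp only [dotProduct]
        exact Finset.sum_nonneg fun j _ => mul_self_nonneg _
      rw [sub_dotProduct, dotProduct_sub, dotProduct_sub, dotProduct_comm w x] at h3
      rw [star_trivial, Matrix.sub_mulVec, Matrix.one_mulVec, hw, dotProduct_sub]
      linarith
  have tr : (1 - ∑ i, (p i)⁻¹ • K i).trace = 0 := by
    rw [trace_sub, trace_sum, trace_one]
    have : ∀ i, ((p i)⁻¹ • K i).trace = (nn i : ℝ) / p i := by
      intro i
      rw [trace_smul, hK]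
      simp only
      rw [Matrix.trace_mul_comm, ← Matrix.mul_assoc, Matrix.mul_nonsing_inv _ (hunit i), trace_one]
      simp; ring
    simp only [this, hsum]
    simp
  have := (psd.trace_eq_zero_iff).1 tr
  exact (sub_eq_zero.1 this).symm

lemma frame_quad {n m : ℕ} {nn : Fin m → ℕ} {p : Fin m → ℝ}
    (T : ∀ i, Matrix (Fin (nn i)) (Fin n) ℝ)
    (h : ∑ i, (p i)⁻¹ • ((T i)ᵀ * (T i * (T i)ᵀ)⁻¹ * T i) = 1) (y : Fin n → ℝ) :
    ∑ i, (p i)⁻¹ * (((T i * (T i)ᵀ)⁻¹ *ᵥ (T i *ᵥ y)) ⬝ᵥ (T i *ᵥ y)) = y ⬝ᵥ y := by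
  have h1 : y ⬝ᵥ ((∑ i, (p i)⁻¹ • ((T i)ᵀ * (T i * (T i)ᵀ)⁻¹ * T i)) *ᵥ y) = y ⬝ᵥ y := by
    rw [h, Matrix.one_mulVec]
  rw [← h1, Matrix.sum_mulVec, dotProduct_sum]
  refine Finset.sum_congr rfl fun i _ => ?_
  rw [Matrix.smul_mulVec, dotProduct_smul, smul_eq_mul, Matrix.mul_assoc, ← Matrix.mulVec_mulVec,
    dot_tr, ← Matrix.mulVec_mulVec]

lemma posdef_block {k n : ℕ} {U : Matrix (Fin k) (Fin n) ℝ} (hU : U.rank = k)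
    {B : Matrix (Fin n) (Fin n) ℝ} (hB : B.PosDef) : (U * B * Uᵀ).PosDef := by
  have hinj : Function.Injective U.vecMul := by
    rw [Matrix.vecMul_injective_iff]
    rw [linearIndependent_iff_card_eq_finrank_span, Set.finrank, ← Matrix.rank_eq_finrank_span_row,
      hU]
    simp
  simpa [conjTranspose_eq_transpose_of_trivial] using hB.mul_mul_conjTranspose_same hinj

lemma cond_quad {n m : ℕ} {nn : Fin m → ℕ} {p : Fin m → ℝ}
    (U : ∀ i, Matrix (Fin (nn i)) (Fin n) ℝ)
    (bigU : Matrix (Σ i : Fin m, Fin (nn i)) (Fin n) ℝ)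
    (hbigU : ∀ a k, bigU a k = U a.1 a.2 k)
    (B S : Matrix (Fin n) (Fin n) ℝ) (hS : B = S * Sᵀ)
    (PD : Matrix (Σ i : Fin m, Fin (nn i)) (Σ i : Fin m, Fin (nn i)) ℝ)
    (hPD : ∀ a b, PD a b = if a.1 = b.1 then p a.1 * (bigU * B * bigUᵀ) a b else 0)
    (hcond : (PD - bigU * B * bigUᵀ).PosSemidef) (u : ∀ i, Fin (nn i) → ℝ) :
    (∑ i, (U i * S)ᵀ *ᵥ u i) ⬝ᵥ (∑ i, (U i * S)ᵀ *ᵥ u i)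
      ≤ ∑ i, p i * (u i ⬝ᵥ (((U i * S) * (U i * S)ᵀ) *ᵥ u i)) := by
  have h := (posSemidef_iff_dotProduct_mulVec.1 hcond).2 (fun a => u a.1 a.2)
  rw [star_trivial, Matrix.sub_mulVec, dotProduct_sub, sub_nonneg] at h
  have hent : ∀ a b, (bigU * B * bigUᵀ) a b = (U a.1 * B * (U b.1)ᵀ) a.2 b.2 := by
    intro a b
    simp only [Matrix.mul_apply, transpose_apply, hbigU]
  have e0 : ∀ i, (U i * S) * (U i * S)ᵀ = U i * B * (U i)ᵀ := by
    intro i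
    rw [hS, transpose_mul]; simp only [Matrix.mul_assoc]
  have e1 : (∑ i, (U i * S)ᵀ *ᵥ u i) ⬝ᵥ (∑ i, (U i * S)ᵀ *ᵥ u i)
      = (fun a : (Σ i : Fin m, Fin (nn i)) => u a.1 a.2) ⬝ᵥ
        ((bigU * B * bigUᵀ) *ᵥ fun a => u a.1 a.2) := by
    have : ∑ i, (U i * S)ᵀ *ᵥ u i = (bigU * S)ᵀ *ᵥ fun a => u a.1 a.2 := by
      ext k
      simp only [Finset.sum_apply, Matrix.mulVec, dotProduct, transpose_apply, Matrix.mul_apply,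
        hbigU, Fintype.sum_sigma]
    rw [this, hS]
    rw [show bigU * (S * Sᵀ) * bigUᵀ = (bigU * S) * (bigU * S)ᵀ by
      rw [transpose_mul]; simp only [Matrix.mul_assoc]]
    rw [← Matrix.mulVec_mulVec, Matrix.dotProduct_mulVec _ (bigU * S), Matrix.mulVec_transpose]
  have e2 : ∑ i, p i * (u i ⬝ᵥ (((U i * S) * (U i * S)ᵀ) *ᵥ u i))
      = (fun a : (Σ i : Fin m, Fin (nn i)) => u a.1 a.2) ⬝ᵥ (PD *ᵥ fun a => u a.1 a.2) := by
    simp only [e0]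
    simp only [dotProduct, Matrix.mulVec, Fintype.sum_sigma, hPD, hent]
    refine Finset.sum_congr rfl fun i _ => ?_
    rw [Finset.mul_sum]
    refine Finset.sum_congr rfl fun a _ => ?_
    rw [Finset.sum_eq_single i]
    · simp only [if_true, Finset.mul_sum]
      refine Finset.sum_congr rfl fun b _ => by ring
    · intro j _ hj
      simp [hj.symm]
    · simp
  rw [e1, e2]
  exact h

lemma p_ge_one {n m : ℕ} {nn : Fin m → ℕ} (hnn : ∀ i, 0 < nn i) {p : Fin m → ℝ}
    (T : ∀ i, Matrix (Fin (nn i)) (Fin n) ℝ)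
    (hA : ∀ i, (T i * (T i)ᵀ).PosDef)
    (hQ : ∀ u : ∀ i, Fin (nn i) → ℝ, (∑ i, (T i)ᵀ *ᵥ u i) ⬝ᵥ (∑ i, (T i)ᵀ *ᵥ u i)
      ≤ ∑ i, p i * (u i ⬝ᵥ ((T i * (T i)ᵀ) *ᵥ u i))) (i : Fin m) : 1 ≤ p i := by
  set e : Fin (nn i) → ℝ := fun _ => 1 with he
  have hne : e ≠ 0 := fun h => by
    have := congrFun h ⟨0, hnn i⟩
    simp [he] at this
  have hpos := (hA i).dotProduct_mulVec_pos hne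
  rw [star_trivial] at hpos
  have h := hQ (Pi.single (M := fun j => Fin (nn j) → ℝ) i e)
  have z : ∀ j, j ≠ i → Pi.single (M := fun j => Fin (nn j) → ℝ) i e j = 0 := fun j hj =>
    Pi.single_eq_of_ne (M := fun j => Fin (nn j) → ℝ) hj e
  rw [Finset.sum_eq_single i (fun j _ hj => by rw [z j hj]; simp) (by simp),
    Finset.sum_eq_single i (fun j _ hj => by rw [z j hj]; simp) (by simp), Pi.single_eq_same,
    dot_tr, dotProduct_comm] at h
  have e1 : (T i *ᵥ ((T i)ᵀ *ᵥ e)) ⬝ᵥ e = e ⬝ᵥ ((T i * (T i)ᵀ) *ᵥ e) := by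
    rw [dotProduct_comm, Matrix.mulVec_mulVec]
  rw [e1] at h
  by_contra hlt
  push Not at hlt
  nlinarith
end BL
namespace BL
open ProbabilityTheory

lemma prod_const_rpow {m : ℕ} {nn : Fin m → ℕ} {p d : Fin m → ℝ} {n : ℕ}
    (hsum : ∑ i, (nn i : ℝ) / p i = n) (hd : ∀ i, 0 ≤ d i) {b : ℝ} (hb : 0 < b) (s : ℝ) :
    ∏ i, (b ^ (s * (nn i : ℝ)) * d i) ^ (1 / p i) = b ^ (s * (n : ℝ)) * ∏ i, d i ^ (1 / p i) := by
  have : ∀ i, (b ^ (s * (nn i : ℝ)) * d i) ^ (1 / p i)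
      = b ^ (s * ((nn i : ℝ) / p i)) * d i ^ (1 / p i) := by
    intro i
    rw [Real.mul_rpow (by positivity) (hd i), ← Real.rpow_mul hb.le]
    congr 2; ring
  simp only [this, Finset.prod_mul_distrib]
  rw [← Real.rpow_sum_of_pos hb, ← Finset.mul_sum, hsum]

lemma det_const {m : ℕ} {p a : Fin m → ℝ} (ha : ∀ i, 0 < a i) {b : ℝ} (hb : 0 ≤ b) :
    Real.sqrt (b / ∏ i, a i ^ (1 / p i))
      = Real.sqrt b * ∏ i, ((Real.sqrt (a i))⁻¹) ^ (1 / p i) := by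
  rw [Real.sqrt_div hb, div_eq_mul_inv]
  congr 1
  rw [Real.sqrt_eq_rpow, ← Real.finsetProd_rpow _ _ fun i _ => Real.rpow_nonneg (ha i).le _,
    ← Finset.prod_inv_distrib]
  refine Finset.prod_congr rfl fun i _ => ?_
  rw [Real.inv_rpow (Real.sqrt_nonneg _), Real.sqrt_eq_rpow, ← Real.rpow_mul (ha i).le,
    ← Real.rpow_mul (ha i).le, mul_comm]

lemma main_ineq {n m : ℕ} {nn : Fin m → ℕ} {p : Fin m → ℝ} (hp : ∀ i, 1 ≤ p i)
    (hsum : ∑ i, (nn i : ℝ) / p i = n) (T : ∀ i, Matrix (Fin (nn i)) (Fin n) ℝ)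
    (hA : ∀ i, (T i * (T i)ᵀ).PosDef)
    (hQ : ∀ u : ∀ i, Fin (nn i) → ℝ, (∑ i, (T i)ᵀ *ᵥ u i) ⬝ᵥ (∑ i, (T i)ᵀ *ᵥ u i)
      ≤ ∑ i, p i * (u i ⬝ᵥ ((T i * (T i)ᵀ) *ᵥ u i)))
    (f : ∀ i, (Fin (nn i) → ℝ) → ℝ) (fm : ∀ i, Measurable (f i)) (f0 : ∀ i x, 0 ≤ f i x)
    (ffin : ∀ i, ∫⁻ z, ENNReal.ofReal (f i z) ^ p i ≠ ⊤) :
    ∫⁻ y, ∏ i, ENNReal.ofReal (f i (T i *ᵥ y))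
      ≤ ENNReal.ofReal (∏ i, ((Real.sqrt (T i * (T i)ᵀ).det)⁻¹) ^ (1 / p i))
        * ∏ i, (∫⁻ z, ENNReal.ofReal (f i z) ^ p i) ^ (1 / p i) := by
  have hp0 : ∀ i, 0 < p i := fun i => lt_of_lt_of_le one_pos (hp i)
  have hc0 : ∀ i, 0 ≤ 1 / p i := fun i => by have := hp0 i; positivity
  have hc1 : ∀ i, 1 / p i ≤ 1 := fun i => by
    rw [div_le_one (hp0 i)]; exact hp i
  have hid := frame_id hp0 hsum T hA hQ
  set q : ∀ i, (Fin (nn i) → ℝ) → ℝ := fun i z => ((T i * (T i)ᵀ)⁻¹ *ᵥ z) ⬝ᵥ z with hq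
  have hqm : ∀ i, Measurable (q i) := fun i => by
    have hmA : Measurable fun y : Fin (nn i) → ℝ => (T i * (T i)ᵀ)⁻¹ *ᵥ y :=
      (LinearMap.continuous_of_finiteDimensional (Matrix.toLin' (T i * (T i)ᵀ)⁻¹)).measurable
    simp only [hq]
    unfold dotProduct; fun_prop
  have hqsum : ∀ y, ∑ i, (p i)⁻¹ * q i (T i *ᵥ y) = y ⬝ᵥ y := frame_quad T hid
  set g : ∀ i, (Fin (nn i) → ℝ) → ℝ := fun i z => f i z ^ p i * Real.exp (q i z / 2) with hg
  have hgm : ∀ i, Measurable (g i) := fun i => by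
    have := fm i
    have := hqm i
    simp only [hg]; fun_prop
  have hg0 : ∀ i z, 0 ≤ g i z := fun i z =>
    mul_nonneg (Real.rpow_nonneg (f0 i z) _) (Real.exp_pos _).le
  have hgi : ∀ i, ∫⁻ y, ENNReal.ofReal (g i (T i *ᵥ y.ofLp))
      ∂(stdGaussian (EuclideanSpace ℝ (Fin n)))
      = ENNReal.ofReal ((2 * Real.pi) ^ (-(1 / 2) * (nn i : ℝ)) * (Real.sqrt (T i * (T i)ᵀ).det)⁻¹)
        * ∫⁻ z, ENNReal.ofReal (f i z) ^ p i := by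
    intro i
    rw [push_density (T i) (hA i) rfl (h := fun z => ENNReal.ofReal (g i z))
      (hgm i).ennreal_ofReal]
    congr 1
    · congr 3; ring
    · refine lintegral_congr fun z => ?_
      rw [← ENNReal.ofReal_mul (hg0 i z), ENNReal.ofReal_rpow_of_nonneg (f0 i z) (hp0 i).le]
      congr 1
      simp only [hg, hq]
      rw [mul_assoc, ← Real.exp_add, show ∀ t : ℝ, t / 2 + -t / 2 = 0 by intro t; ring,
        Real.exp_zero, mul_one]
  have hT : ∀ u : ∀ i, EuclideanSpace ℝ (Fin (nn i)),
      ‖∑ i, (1 / p i) • ContinuousLinearMap.adjoint (mL (T i)) (u i)‖ ^ 2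
        ≤ ∑ i, (1 / p i) * ‖ContinuousLinearMap.adjoint (mL (T i)) (u i)‖ ^ 2 := by
    intro u
    have h := hQ fun i => (1 / p i) • (u i).ofLp
    simp only [normsq, mL_adj]
    have e1 : (∑ i, (1 / p i) • mL (T i)ᵀ (u i)).ofLp
        = ∑ i, (T i)ᵀ *ᵥ ((1 / p i) • (u i).ofLp) := by
      simp only [WithLp.ofLp_sum, WithLp.ofLp_smul, mL_apply, Matrix.mulVec_smul]
    rw [e1]
    refine h.trans_eq (Finset.sum_congr rfl fun i _ => ?_)
    rw [mL_apply, dot_tr, Matrix.mulVec_mulVec, Matrix.mulVec_smul, dotProduct_smul,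
      smul_dotProduct, smul_eq_mul, smul_eq_mul]
    have := (hp0 i).ne'
    field_simp
  have main := gauss_ineq (fun i => mL (T i)) hc0 hc1 hT (fun i z => g i z.ofLp)
    (fun i => by have := hgm i; fun_prop) (fun i z => hg0 i _) (fun i => by
      simp only [mL_apply]
      rw [hgi i]
      exact ENNReal.mul_ne_top ENNReal.ofReal_ne_top (ffin i))
  simp only [mL_apply] at main
  simp only [hgi] at main
  have hTm : ∀ i, Measurable fun y : Fin n → ℝ => T i *ᵥ y := fun i =>
    (LinearMap.continuous_of_finiteDimensional (Matrix.toLin' (T i))).measurable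
  have lhs : ∫⁻ y, ∏ i, ENNReal.ofReal (g i (T i *ᵥ y.ofLp)) ^ (1 / p i)
      ∂(stdGaussian (EuclideanSpace ℝ (Fin n)))
      = ENNReal.ofReal ((2 * Real.pi) ^ (-(1 / 2) * (n : ℝ)))
        * ∫⁻ y, ∏ i, ENNReal.ofReal (f i (T i *ᵥ y)) := by
    rw [std_density (h := fun y => ∏ i, ENNReal.ofReal (g i (T i *ᵥ y)) ^ (1 / p i))
      (Finset.measurable_prod _ fun i _ =>
        (((hgm i).comp (hTm i)).ennreal_ofReal.pow_const _))]
    congr 1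
    · congr 2; ring
    · refine lintegral_congr fun y => ?_
      have e1 : ∀ i, ENNReal.ofReal (g i (T i *ᵥ y)) ^ (1 / p i)
          = ENNReal.ofReal (f i (T i *ᵥ y)) *
            ENNReal.ofReal (Real.exp ((p i)⁻¹ * q i (T i *ᵥ y) / 2)) := by
        intro i
        rw [ENNReal.ofReal_rpow_of_nonneg (hg0 i _) (hc0 i), ← ENNReal.ofReal_mul (f0 i _)]
        congr 1
        simp only [hg]
        rw [Real.mul_rpow (Real.rpow_nonneg (f0 i _) _) (Real.exp_pos _).le,
          ← Real.rpow_mul (f0 i _), mul_one_div_cancel (hp0 i).ne', Real.rpow_one, ← Real.exp_mul]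
        congr 2; ring
      simp only [e1, Finset.prod_mul_distrib]
      rw [← ENNReal.ofReal_prod_of_nonneg fun i _ => (Real.exp_pos _).le, ← Real.exp_sum,
        ← Finset.sum_div, hqsum, mul_assoc, ← ENNReal.ofReal_mul (Real.exp_pos _).le,
        ← Real.exp_add, show ∀ t : ℝ, t / 2 + -t / 2 = 0 by intro t; ring, Real.exp_zero]
      simp
  rw [lhs] at main
  have rhs : ∏ i, (ENNReal.ofReal ((2 * Real.pi) ^ (-(1 / 2) * (nn i : ℝ))
        * (Real.sqrt (T i * (T i)ᵀ).det)⁻¹) * ∫⁻ z, ENNReal.ofReal (f i z) ^ p i) ^ (1 / p i)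
      = ENNReal.ofReal ((2 * Real.pi) ^ (-(1 / 2) * (n : ℝ))) *
        (ENNReal.ofReal (∏ i, ((Real.sqrt (T i * (T i)ᵀ).det)⁻¹) ^ (1 / p i))
        * ∏ i, (∫⁻ z, ENNReal.ofReal (f i z) ^ p i) ^ (1 / p i)) := by
    have e1 := fun i => ENNReal.mul_rpow_of_nonneg (ENNReal.ofReal ((2 * Real.pi) ^
      (-(1 / 2) * (nn i : ℝ)) * (Real.sqrt (T i * (T i)ᵀ).det)⁻¹))
      (∫⁻ z, ENNReal.ofReal (f i z) ^ p i) (hc0 i)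
    simp only [e1, Finset.prod_mul_distrib]
    rw [← mul_assoc, ← ENNReal.ofReal_mul (by positivity),
      ← prod_const_rpow hsum (fun i => by positivity) (by positivity) (-(1 / 2)),
      ENNReal.ofReal_prod_of_nonneg fun i _ => by positivity]
    congr 1
    exact Finset.prod_congr rfl fun i _ => ENNReal.ofReal_rpow_of_nonneg (by positivity) (hc0 i)
  rw [rhs] at main
  refine (ENNReal.mul_le_mul_iff_right ?_ ENNReal.ofReal_ne_top).1 main
  rw [ne_eq, ENNReal.ofReal_eq_zero, not_le]
  positivity
end BL

theorem stmt10
    (n m : ℕ) (hn : 0 < n) (hm : 0 < m)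
    (nn : Fin m → ℕ) (hnn : ∀ i, 0 < nn i) (hnnle : ∀ i, nn i ≤ n)
    (p : Fin m → ℝ) (hsum : ∑ i, (nn i : ℝ) / p i = n)
    (U : ∀ i, Matrix (Fin (nn i)) (Fin n) ℝ) (hUrank : ∀ i, (U i).rank = nn i)
    (bigU : Matrix (Σ i : Fin m, Fin (nn i)) (Fin n) ℝ)
    (hbigU : ∀ a k, bigU a k = U a.1 a.2 k)
    (B : Matrix (Fin n) (Fin n) ℝ) (hB : B.PosDef)
    (PD : Matrix (Σ i : Fin m, Fin (nn i)) (Σ i : Fin m, Fin (nn i)) ℝ)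
    (hPD : ∀ a b, PD a b = if a.1 = b.1 then p a.1 * (bigU * B * bigUᵀ) a b else 0)
    (hcond : (PD - bigU * B * bigUᵀ).PosSemidef) :
    (∀ f : ∀ i, (Fin (nn i) → ℝ) → ℝ, (∀ i, Measurable (f i)) →
      (∀ i x, 0 ≤ f i x) →
      (∀ i, ∫⁻ z, ENNReal.ofReal (f i z) ^ p i ≠ ⊤) →
      ∫⁻ x, ∏ i, ENNReal.ofReal (f i ((U i).mulVec x))
        ≤ ENNReal.ofReal
            (Real.sqrt (B.det / ∏ i, (U i * B * (U i)ᵀ).det ^ (1 / p i)))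
          * ∏ i, (∫⁻ z, ENNReal.ofReal (f i z) ^ p i) ^ (1 / p i)) ∧
    (∫⁻ x, ∏ i, ENNReal.ofReal
        (Real.exp (-(p i)⁻¹ *
          (((U i * B * (U i)ᵀ)⁻¹).mulVec ((U i).mulVec x) ⬝ᵥ (U i).mulVec x)))
      = ENNReal.ofReal
          (Real.sqrt (B.det / ∏ i, (U i * B * (U i)ᵀ).det ^ (1 / p i)))
        * ∏ i, (∫⁻ z, ENNReal.ofReal
            (Real.exp (-(p i)⁻¹ * (((U i * B * (U i)ᵀ)⁻¹).mulVec z ⬝ᵥ z))) ^ p i)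
              ^ (1 / p i)) := by
  obtain ⟨S, hS, hSd, hSdet⟩ := BL.exists_factor hB
  have hA : ∀ i, (U i * B * (U i)ᵀ).PosDef := fun i => BL.posdef_block (hUrank i) hB
  have eA : ∀ i, U i * B * (U i)ᵀ = (U i * S) * (U i * S)ᵀ := fun i => by
    rw [hS, transpose_mul]; simp only [Matrix.mul_assoc]
  have hA' : ∀ i, ((U i * S) * (U i * S)ᵀ).PosDef := fun i => eA i ▸ hA i
  have hQ := BL.cond_quad U bigU hbigU B S hS PD hPD hcond
  have hp1 := BL.p_ge_one hnn (fun i => U i * S) hA' hQ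
  have hp0 : ∀ i, 0 < p i := fun i => lt_of_lt_of_le one_pos (hp1 i)
  have hUm : ∀ i, Measurable fun y : Fin n → ℝ => U i *ᵥ y := fun i =>
    (LinearMap.continuous_of_finiteDimensional (Matrix.toLin' (U i))).measurable
  have hconst : Real.sqrt (B.det / ∏ i, (U i * B * (U i)ᵀ).det ^ (1 / p i))
      = Real.sqrt B.det * ∏ i, ((Real.sqrt (U i * B * (U i)ᵀ).det)⁻¹) ^ (1 / p i) :=
    BL.det_const (fun i => (hA i).det_pos) hB.det_pos.le
  rw [hconst, ENNReal.ofReal_mul (Real.sqrt_nonneg _), ← hSdet]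
  constructor
  · intro f fm f0 ffin
    have := BL.main_ineq hp1 hsum (fun i => U i * S) hA' hQ f fm f0 ffin
    rw [BL.lin_cov hSd (h := fun x => ∏ i, ENNReal.ofReal (f i (U i *ᵥ x)))
      (Finset.measurable_prod _ fun i _ => ((fm i).comp (hUm i)).ennreal_ofReal), mul_assoc]
    simp only [Matrix.mulVec_mulVec, eA]
    gcongr
  · have hqm : ∀ i, Measurable fun z : Fin (nn i) → ℝ => ((U i * B * (U i)ᵀ)⁻¹ *ᵥ z) ⬝ᵥ z := by
      intro i
      have hmA : Measurable fun y : Fin (nn i) → ℝ => (U i * B * (U i)ᵀ)⁻¹ *ᵥ y :=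
        (LinearMap.continuous_of_finiteDimensional
          (Matrix.toLin' (U i * B * (U i)ᵀ)⁻¹)).measurable
      unfold dotProduct; fun_prop
    have hquad := BL.frame_quad (fun i => U i * S)
      (BL.frame_id hp0 hsum (fun i => U i * S) hA' hQ)
    simp only [← eA] at hquad
    rw [BL.lin_cov hSd (h := fun x => ∏ i, ENNReal.ofReal
        (Real.exp (-(p i)⁻¹ *
          (((U i * B * (U i)ᵀ)⁻¹).mulVec ((U i).mulVec x) ⬝ᵥ (U i).mulVec x))))
      (Finset.measurable_prod _ fun i _ =>
        ((((hqm i).comp (hUm i)).const_mul _).exp).ennreal_ofReal), mul_assoc]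
    congr 1
    have e1 : ∀ y : Fin n → ℝ, ∏ i, ENNReal.ofReal
        (Real.exp (-(p i)⁻¹ *
          (((U i * B * (U i)ᵀ)⁻¹).mulVec ((U i).mulVec (S *ᵥ y)) ⬝ᵥ (U i).mulVec (S *ᵥ y))))
        = ENNReal.ofReal (Real.exp (-(((1 : Matrix (Fin n) (Fin n) ℝ)⁻¹ *ᵥ y) ⬝ᵥ y))) := by
      intro y
      rw [← ENNReal.ofReal_prod_of_nonneg fun i _ => (Real.exp_pos _).le, ← Real.exp_sum,
        inv_one, Matrix.one_mulVec, ← hquad y, ← Finset.sum_neg_distrib]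
      simp only [Matrix.mulVec_mulVec, neg_mul]
    simp only [e1]
    rw [BL.gauss_integral PosDef.one]
    have e2 : ∀ i, ∫⁻ z, ENNReal.ofReal
            (Real.exp (-(p i)⁻¹ * (((U i * B * (U i)ᵀ)⁻¹).mulVec z ⬝ᵥ z))) ^ p i
        = ENNReal.ofReal (Real.pi ^ ((1 / 2) * (nn i : ℝ)) * Real.sqrt (U i * B * (U i)ᵀ).det) := by
      intro i
      rw [show (1 / 2) * (nn i : ℝ) = (nn i : ℝ) / 2 by ring, ← BL.gauss_integral (hA i)]
      refine lintegral_congr fun z => ?_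
      rw [ENNReal.ofReal_rpow_of_nonneg (Real.exp_pos _).le (hp0 i).le, ← Real.exp_mul]
      congr 2
      have := (hp0 i).ne'
      field_simp
    have hc0 : ∀ i, 0 ≤ 1 / p i := fun i => by have := hp0 i; positivity
    have e3 : ∀ i, ENNReal.ofReal (Real.pi ^ ((1 / 2) * (nn i : ℝ))
          * Real.sqrt (U i * B * (U i)ᵀ).det) ^ (1 / p i)
        = ENNReal.ofReal ((Real.pi ^ ((1 / 2) * (nn i : ℝ))
          * Real.sqrt (U i * B * (U i)ᵀ).det) ^ (1 / p i)) := fun i =>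
      ENNReal.ofReal_rpow_of_nonneg (by positivity) (hc0 i)
    simp only [e2, e3]
    rw [← ENNReal.ofReal_prod_of_nonneg fun i _ => by positivity,
      BL.prod_const_rpow hsum (fun i => Real.sqrt_nonneg _) Real.pi_pos,
      ← ENNReal.ofReal_mul (by positivity), mul_left_comm, ← Finset.prod_mul_distrib]
    congr 1
    have e4 : ∀ i, ((Real.sqrt (U i * B * (U i)ᵀ).det)⁻¹) ^ (1 / p i)
        * Real.sqrt (U i * B * (U i)ᵀ).det ^ (1 / p i) = 1 := by
      intro i
      have := Real.sqrt_pos.2 (hA i).det_pos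
      rw [← Real.mul_rpow (by positivity) (by positivity), inv_mul_cancel₀ this.ne', Real.one_rpow]
    simp only [e4, Finset.prod_const_one, mul_one, det_one, Real.sqrt_one]
    congr 1; ring
end
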